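/- arXiv:1911.05794 — 5 statements merged into one kernel-verified Lean document; each statement's English description precedes it below -/
import Mathlib

section
/- For every n ≥ 8, let H_n be the graph obtained from the complete bipartite graph K_{2,n−2} by adding the edge between the two vertices of the partite set of cardinality 2. Then μ(H_n) < μ(K_{2,n−2}). -/
open Filter Topology

noncomputable section

namespace SubtreePaper

/-- The set of subtrees of `G`: subgraphs of `G` that are (nonempty) trees. -/
def subtrees {V : Type*} (G : SimpleGraph V) : Set G.Subgraph :=
  {H | H.coe.IsTree}

/-- The number of subtrees of `G`. -/
def numSubtrees {V : Type*} (G : SimpleGraph V) : ℕ := (subtrees G).ncard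

/-- The mean subtree order of `G`. -/
def mu {V : Type*} (G : SimpleGraph V) : ℝ :=
  (∑ᶠ H ∈ subtrees G, (H.verts.ncard : ℝ)) / (numSubtrees G)

/-- The density of `G`. -/
def den {V : Type*} [Fintype V] (G : SimpleGraph V) : ℝ :=
  mu G / (Fintype.card V)

/-- The local mean subtree order of `G` at an edge `e`. -/
def muEdge {V : Type*} (G : SimpleGraph V) (e : Sym2 V) : ℝ :=
  (∑ᶠ H ∈ {H ∈ subtrees G | e ∈ H.edgeSet}, (H.verts.ncard : ℝ)) /
    ({H ∈ subtrees G | e ∈ H.edgeSet}.ncard)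

/-- The local mean subtree order of `G` at a vertex `u`. -/
def muVert {V : Type*} (G : SimpleGraph V) (u : V) : ℝ :=
  (∑ᶠ H ∈ {H ∈ subtrees G | u ∈ H.verts}, (H.verts.ncard : ℝ)) /
    ({H ∈ subtrees G | u ∈ H.verts}.ncard)

/-- The graph obtained from `G` by adding an edge between `u` and `v`. -/
def addEdge {V : Type*} (G : SimpleGraph V) (u v : V) : SimpleGraph V :=
  G ⊔ SimpleGraph.fromEdgeSet {s(u, v)}


/-- The graph `H_n`, obtained from `K_{2,n-2}` by joining the two vertices of the
partite set of cardinality `2`. -/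
def Hgraph (n : ℕ) : SimpleGraph (Fin 2 ⊕ Fin (n - 2)) :=
  addEdge (completeBipartiteGraph (Fin 2) (Fin (n - 2))) (Sum.inl 0) (Sum.inl 1)

/-- A finite subgraph in which every vertex other than `r` has a parent closer to `r`, all edges
joining a vertex to its parent, is a tree. -/
theorem isTree_coe_of_parent {V : Type*} [Finite V] {G : SimpleGraph V} (T : G.Subgraph) (r : V)
    (hr : r ∈ T.verts) (p : V → V) (h : V → ℕ)
    (hp : ∀ v ∈ T.verts, v ≠ r → T.Adj v (p v) ∧ h (p v) < h v)
    (hT : ∀ u v, T.Adj u v → (u ≠ r ∧ p u = v) ∨ (v ≠ r ∧ p v = u)) : T.coe.IsTree := by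
  have reach : ∀ k (v : T.verts), h v = k → T.coe.Reachable v ⟨r, hr⟩ := by
    intro k
    induction k using Nat.strong_induction_on with
    | _ k ih =>
      rintro ⟨v, hv⟩ rfl
      by_cases hvr : v = r
      · subst hvr
        exact .rfl
      · obtain ⟨hadj, hlt⟩ := hp v hv hvr
        have h1 : T.coe.Adj ⟨v, hv⟩ ⟨p v, T.edge_vert hadj.symm⟩ := hadj
        exact h1.reachable.trans (ih _ hlt _ rfl)
  have hconn : T.coe.Connected :=
    { preconnected := fun u v => (reach _ u rfl).trans (reach _ v rfl).symm
      nonempty := ⟨⟨r, hr⟩⟩ }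
  rw [SimpleGraph.isTree_iff_connected_and_card]
  refine ⟨hconn, le_antisymm ?_ hconn.card_vert_le_card_edgeSet_add_one⟩
  let φ : {v : T.verts // v ≠ ⟨r, hr⟩} → T.coe.edgeSet := fun v =>
    ⟨s(v.1, ⟨p v.1, T.edge_vert
      (hp v.1 v.1.2 (fun e => v.2 (Subtype.ext e))).1.symm⟩),
      (hp v.1 v.1.2 (fun e => v.2 (Subtype.ext e))).1⟩
  have hφ : Function.Surjective φ := by
    rintro ⟨e, he⟩
    induction e using Sym2.ind with
    | _ u v =>
      rcases hT u v he with ⟨hu, hpu⟩ | ⟨hv, hpv⟩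
      · exact ⟨⟨u, fun e => hu (congrArg Subtype.val e)⟩, by simp [φ, hpu]⟩
      · exact ⟨⟨v, fun e => hv (congrArg Subtype.val e)⟩, by simp [φ, hpv, Sym2.eq_swap]⟩
  have h1 := Nat.card_le_card_of_surjective φ hφ
  have h2 : Nat.card {v : T.verts // v ≠ ⟨r, hr⟩} + 1 = Nat.card T.verts := by
    classical
    have := Fintype.ofFinite V
    have := Fintype.ofFinite T.verts
    rw [Nat.card_eq_fintype_card, Nat.card_eq_fintype_card, Fintype.card_subtype_compl,
      Fintype.card_subtype_eq]
    have : 0 < Fintype.card T.verts := Fintype.card_pos_iff.2 ⟨⟨r, hr⟩⟩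
    omega
  omega

theorem not_adj_self {V : Type*} {G : SimpleGraph V} (T : G.Subgraph) (v : V) : ¬ T.Adj v v :=
  fun h => h.adj_sub.ne rfl

/-- In a connected subgraph, some edge leaves every set separating two vertices. -/
theorem exists_adj_of_connected {V : Type*} {G : SimpleGraph V} {T : G.Subgraph}
    (hT : T.coe.Connected) (S : Set V) {a b : V} (ha : a ∈ T.verts) (hb : b ∈ T.verts)
    (haS : a ∈ S) (hbS : b ∉ S) : ∃ u v, T.Adj u v ∧ u ∈ S ∧ v ∉ S := by
  obtain ⟨w⟩ := hT.preconnected ⟨a, ha⟩ ⟨b, hb⟩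
  obtain ⟨d, -, h1, h2⟩ := w.exists_boundary_dart (Subtype.val ⁻¹' S) haS hbS
  exact ⟨d.fst, d.snd, d.adj, h1, h2⟩

theorem exists_neighbor_of_connected {V : Type*} {G : SimpleGraph V} {T : G.Subgraph}
    (hT : T.coe.Connected) {a b : V} (ha : a ∈ T.verts) (hb : b ∈ T.verts) (hab : a ≠ b) :
    ∃ v, T.Adj a v := by
  obtain ⟨u, v, h, rfl, -⟩ := exists_adj_of_connected hT {a} ha hb rfl hab.symm
  exact ⟨v, h⟩

theorem not_adj_of_common_neighbor {V : Type*} {G : SimpleGraph V} {T : G.Subgraph}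
    (hT : T.coe.IsAcyclic) {a b c : V} (hac : T.Adj a c) (hcb : T.Adj c b) : ¬ T.Adj a b := by
  intro hab
  let a' : T.verts := ⟨a, T.edge_vert hac⟩
  let b' : T.verts := ⟨b, T.edge_vert hab.symm⟩
  let c' : T.verts := ⟨c, T.edge_vert hcb⟩
  have h1 : T.coe.Adj a' c' := hac
  have h2 : T.coe.Adj c' b' := hcb
  have h3 : T.coe.Adj a' b' := hab
  have := hT.subsingleton_path a' b' |>.elim
    ⟨.cons h1 (.cons h2 .nil), by simp [h1.ne, h2.ne, h3.ne]⟩ ⟨.cons h3 .nil, by simp [h3.ne]⟩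
  have := congrArg (fun p => p.1.length) this
  simp at this

theorem common_neighbor_unique {V : Type*} {G : SimpleGraph V} {T : G.Subgraph}
    (hT : T.coe.IsAcyclic) {a b c d : V} (hab : a ≠ b) (hac : T.Adj a c) (hcb : T.Adj c b)
    (had : T.Adj a d) (hdb : T.Adj d b) : c = d := by
  let a' : T.verts := ⟨a, T.edge_vert hac⟩
  let b' : T.verts := ⟨b, T.edge_vert hcb.symm⟩
  let c' : T.verts := ⟨c, T.edge_vert hcb⟩
  let d' : T.verts := ⟨d, T.edge_vert hdb⟩
  have h1 : T.coe.Adj a' c' := hac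
  have h2 : T.coe.Adj c' b' := hcb
  have h3 : T.coe.Adj a' d' := had
  have h4 : T.coe.Adj d' b' := hdb
  have hne : a' ≠ b' := fun e => hab (congrArg Subtype.val e)
  have := hT.subsingleton_path a' b' |>.elim
    ⟨.cons h1 (.cons h2 .nil), by simp [h1.ne, h2.ne, hne]⟩
    ⟨.cons h3 (.cons h4 .nil), by simp [h3.ne, h4.ne, hne]⟩
  have := congrArg (fun p => p.1.support) this
  simpa [c', d'] using this

/-- `G` is `K_{2,ι}`, possibly with additional edges inside the part of cardinality `2`. -/
structure IsTwoBipartite {ι : Type*} (G : SimpleGraph (Fin 2 ⊕ ι)) : Prop where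
  adj_inl_inr : ∀ x j, G.Adj (.inl x) (.inr j)
  not_adj_inr : ∀ i j, ¬ G.Adj (.inr i) (.inr j)

section Families

variable {ι : Type*} (G : SimpleGraph (Fin 2 ⊕ ι))

/-- The relation on `Fin 2 ⊕ ι` given by `r` between the two parts and by `e` inside `Fin 2`. -/
def crossRel (r : ι → Fin 2 → Prop) (e : Prop) : Fin 2 ⊕ ι → Fin 2 ⊕ ι → Prop
  | .inl _, .inl _ => e
  | .inl x, .inr j => r j x
  | .inr j, .inl x => r j x
  | .inr _, .inr _ => False

/-- The subgraph of `G` on `A ⊔ B` whose edges are the edges of `G` allowed by `crossRel r e`. -/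
def crossSubgraph (A : Set (Fin 2)) (B : Set ι) (r : ι → Fin 2 → Prop) (e : Prop) :
    G.Subgraph where
  verts := {v | Sum.elim (· ∈ A) (· ∈ B) v}
  Adj u v := G.Adj u v ∧ Sum.elim (· ∈ A) (· ∈ B) u ∧ Sum.elim (· ∈ A) (· ∈ B) v ∧ crossRel r e u v
  adj_sub h := h.1
  edge_vert h := h.2.1
  symm := ⟨by
    rintro (x | i) (y | j) ⟨h1, h2, h3, h4⟩ <;> exact ⟨h1.symm, h3, h2, h4⟩⟩

variable {G} {A : Set (Fin 2)} {B : Set ι} {r : ι → Fin 2 → Prop} {e : Prop}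

@[simp] theorem inl_mem_crossSubgraph {x : Fin 2} :
    .inl x ∈ (crossSubgraph G A B r e).verts ↔ x ∈ A := .rfl

@[simp] theorem inr_mem_crossSubgraph {j : ι} :
    .inr j ∈ (crossSubgraph G A B r e).verts ↔ j ∈ B := .rfl

@[simp] theorem crossSubgraph_adj_inl_inl {x y : Fin 2} :
    (crossSubgraph G A B r e).Adj (.inl x) (.inl y) ↔
      G.Adj (.inl x) (.inl y) ∧ x ∈ A ∧ y ∈ A ∧ e := .rfl

@[simp] theorem crossSubgraph_adj_inr_inr {i j : ι} :
    ¬ (crossSubgraph G A B r e).Adj (.inr i) (.inr j) := fun h => h.2.2.2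

theorem crossSubgraph_adj_inl_inr (hG : IsTwoBipartite G) {x : Fin 2} {j : ι} :
    (crossSubgraph G A B r e).Adj (.inl x) (.inr j) ↔ x ∈ A ∧ j ∈ B ∧ r j x :=
  and_iff_right (hG.adj_inl_inr x j)

theorem crossSubgraph_adj_inr_inl (hG : IsTwoBipartite G) {x : Fin 2} {j : ι} :
    (crossSubgraph G A B r e).Adj (.inr j) (.inl x) ↔ x ∈ A ∧ j ∈ B ∧ r j x := by
  rw [SimpleGraph.Subgraph.adj_comm, crossSubgraph_adj_inl_inr hG]

theorem eq_crossSubgraph (hG : IsTwoBipartite G) (T : G.Subgraph)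
    (hA : ∀ x, .inl x ∈ T.verts ↔ x ∈ A) (hB : ∀ j, .inr j ∈ T.verts ↔ j ∈ B)
    (hr : ∀ x ∈ A, ∀ j ∈ B, T.Adj (.inl x) (.inr j) ↔ r j x)
    (he : T.Adj (.inl 0) (.inl 1) ↔ G.Adj (.inl 0) (.inl 1) ∧ 0 ∈ A ∧ 1 ∈ A ∧ e) :
    T = crossSubgraph G A B r e := by
  have key : ∀ x j, T.Adj (.inl x) (.inr j) ↔ x ∈ A ∧ j ∈ B ∧ r j x := fun x j =>
    ⟨fun h => have hx := (hA x).1 (T.edge_vert h)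
      have hj := (hB j).1 (T.edge_vert h.symm)
      ⟨hx, hj, (hr x hx j hj).1 h⟩, fun h => (hr x h.1 j h.2.1).2 h.2.2⟩
  ext u v
  · rcases u with x | j
    · exact hA x
    · exact hB j
  · rcases u with x | i <;> rcases v with y | j
    · rw [crossSubgraph_adj_inl_inl]
      fin_cases x <;> fin_cases y
      · simp [not_adj_self]
      · exact he
      · rw [T.adj_comm, G.adj_comm]
        exact he.trans (by tauto)
      · simp [not_adj_self]
    · rw [crossSubgraph_adj_inl_inr hG, key]
    · rw [crossSubgraph_adj_inr_inl hG, T.adj_comm, key]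
    · simp only [crossSubgraph_adj_inr_inr, iff_false]
      exact fun h => hG.not_adj_inr i j h.adj_sub

theorem ncard_verts_crossSubgraph [Finite ι] :
    (crossSubgraph G A B r e).verts.ncard = A.ncard + B.ncard := by
  have : (crossSubgraph G A B r e).verts = Sum.inl '' A ∪ Sum.inr '' B := by
    ext (x | j) <;> simp
  rw [this, Set.ncard_union_eq, Set.ncard_image_of_injective _ Sum.inl_injective,
    Set.ncard_image_of_injective _ Sum.inr_injective]
  rw [Set.disjoint_left]
  rintro _ ⟨x, -, rfl⟩ ⟨j, -, h⟩
  simp at h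

variable (G)

/-- The subtree consisting of a single vertex of the part `ι`. -/
def leafTree (i : ι) : G.Subgraph := crossSubgraph G ∅ {i} (fun _ _ => False) False

/-- The star centred at `x` whose leaves are the `j` with `f j = true`. -/
def starTree (x : Fin 2) (f : ι → Bool) : G.Subgraph :=
  crossSubgraph G {x} {j | f j = true} (fun _ _ => True) False

/-- In `doubleStar i f`, the vertex `i` is joined to both vertices of `Fin 2`, and every other
vertex `j` of the part `ι` only to `f j`, if defined. -/
def doubleStarRel (i : ι) (f : {j // j ≠ i} → Option (Fin 2)) (j : ι) (x : Fin 2) : Prop :=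
  j = i ∨ ∃ h : j ≠ i, f ⟨j, h⟩ = some x

/-- The subtree containing both vertices of `Fin 2`, joined through `i`, with the other vertices
attached as prescribed by `f`. -/
def doubleStar (i : ι) (f : {j // j ≠ i} → Option (Fin 2)) : G.Subgraph :=
  crossSubgraph G Set.univ {j | ∃ x, doubleStarRel i f j x} (doubleStarRel i f) False

/-- The subtree containing the edge inside `Fin 2`, with the other vertices attached as prescribed
by `f`. -/
def edgeTree (f : ι → Option (Fin 2)) : G.Subgraph :=
  crossSubgraph G Set.univ {j | ∃ x, f j = some x} (fun j x => f j = some x) True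

/-- All subtrees avoiding the edge inside `Fin 2`. -/
def noEdgeTree : ι ⊕ (Fin 2 × (ι → Bool)) ⊕ (Σ i : ι, ({j // j ≠ i} → Option (Fin 2))) →
    G.Subgraph :=
  Sum.elim (leafTree G) (Sum.elim (fun p => starTree G p.1 p.2) (fun p => doubleStar G p.1 p.2))

variable {G}

theorem edgeTree_injective (hG : IsTwoBipartite G) : Function.Injective (edgeTree G) := by
  intro f g h
  have key : ∀ f j x, f j = some x ↔ (edgeTree G f).Adj (.inl x) (.inr j) := by
    intro f j x
    simp only [edgeTree, crossSubgraph_adj_inl_inr hG, Set.mem_univ, true_and, Set.mem_ofPred_eq]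
    exact ⟨fun h => ⟨⟨x, h⟩, h⟩, And.right⟩
  funext j
  ext x
  rw [key, key, h]

theorem doubleStar_adj (hG : IsTwoBipartite G) {i j : ι} {f : {j // j ≠ i} → Option (Fin 2)}
    {x : Fin 2} : (doubleStar G i f).Adj (.inl x) (.inr j) ↔ doubleStarRel i f j x := by
  simp only [doubleStar, crossSubgraph_adj_inl_inr hG, Set.mem_univ, true_and, Set.mem_ofPred_eq]
  exact ⟨And.right, fun h => ⟨⟨x, h⟩, h⟩⟩

theorem doubleStar_injective (hG : IsTwoBipartite G) :
    Function.Injective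
      (fun p : (Σ i : ι, ({j // j ≠ i} → Option (Fin 2))) => doubleStar G p.1 p.2) := by
  rintro ⟨i, f⟩ ⟨i', g⟩ h
  have key : ∀ j x, doubleStarRel i f j x ↔ doubleStarRel i' g j x := by
    intro j x
    rw [← doubleStar_adj hG, ← doubleStar_adj hG]
    exact iff_of_eq (congrArg (fun T : G.Subgraph => T.Adj (.inl x) (.inr j)) h)
  have hi : i = i' := by
    rcases (key i 0).1 (.inl rfl) with h0 | ⟨h0, h0'⟩
    · exact h0
    · rcases (key i 1).1 (.inl rfl) with h1 | ⟨h1, h1'⟩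
      · exact h1
      · simp [h0'] at h1'
  subst hi
  congr 1
  funext ⟨j, hj⟩
  ext x
  simpa [doubleStarRel, hj] using key j x

theorem starTree_injective : Function.Injective
    (fun p : Fin 2 × (ι → Bool) => starTree G p.1 p.2) := by
  rintro ⟨x, f⟩ ⟨y, g⟩ h
  have h1 : ∀ v, v ∈ (starTree G x f).verts ↔ v ∈ (starTree G y g).verts := fun v =>
    iff_of_eq (congrArg (fun T : G.Subgraph => v ∈ T.verts) h)
  have h2 : x = y := by simpa [starTree] using h1 (.inl x)
  subst h2
  congr 1
  funext j
  exact Bool.eq_iff_iff.2 (h1 (.inr j))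

theorem noEdgeTree_injective (hG : IsTwoBipartite G) : Function.Injective (noEdgeTree G) := by
  refine Function.Injective.sumElim ?_ (Function.Injective.sumElim starTree_injective
    (doubleStar_injective hG) ?_) ?_
  · intro i j h
    have : Sum.inr i ∈ (leafTree G j).verts := h ▸ (by simp [leafTree])
    simpa [leafTree] using this
  · rintro ⟨x, f⟩ ⟨i, g⟩ h
    have h1 : ∀ y, y = x := by
      intro y
      have : Sum.inl y ∈ (starTree G x f).verts := by
        rw [show starTree G x f = doubleStar G i g from h]
        simp [doubleStar]
      simpa [starTree] using this
    have := (h1 0).trans (h1 1).symm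
    simp at this
  · rintro i (⟨x, f⟩ | ⟨k, g⟩) h
    · have : Sum.inl x ∈ (leafTree G i).verts := by
        rw [show leafTree G i = starTree G x f from h]
        simp [starTree]
      simp [leafTree] at this
    · have : Sum.inl 0 ∈ (leafTree G i).verts := by
        rw [show leafTree G i = doubleStar G k g from h]
        simp [doubleStar]
      simp [leafTree] at this

end Families

section Classification

variable {ι : Type*} {G : SimpleGraph (Fin 2 ⊕ ι)}

theorem leafTree_mem_subtrees [Finite ι] (i : ι) : leafTree G i ∈ subtrees G := by
  refine isTree_coe_of_parent _ (.inr i) (by simp [leafTree]) id (fun _ => 0) ?_ ?_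
  · rintro (x | j) hv hne <;> simp_all [leafTree]
  · rintro (x | j) (y | k) h <;> simp_all [leafTree, crossSubgraph, crossRel]

theorem starTree_mem_subtrees [Finite ι] (hG : IsTwoBipartite G) (x : Fin 2) (f : ι → Bool) :
    starTree G x f ∈ subtrees G := by
  refine isTree_coe_of_parent _ (.inl x) (by simp [starTree]) (fun _ => .inl x)
    (Sum.elim (fun _ => 0) (fun _ => 1)) ?_ ?_
  · rintro (y | j) hv hne
    · simp_all [starTree]
    · simp_all [starTree, crossSubgraph_adj_inr_inl hG]
  · rintro (y | j) (z | k) h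
    · simp [starTree] at h
    · simp_all [starTree, crossSubgraph_adj_inl_inr hG]
    · simp_all [starTree, crossSubgraph_adj_inr_inl hG]
    · simp [starTree] at h

theorem edgeTree_mem_subtrees [Finite ι] (hG : IsTwoBipartite G)
    (he : G.Adj (.inl 0) (.inl 1)) (f : ι → Option (Fin 2)) : edgeTree G f ∈ subtrees G := by
  refine isTree_coe_of_parent _ (.inl 0) (by simp [edgeTree])
    (Sum.elim (fun _ => .inl 0) (fun j => .inl ((f j).getD 0)))
    (Sum.elim (fun x => x.val) (fun _ => 2)) ?_ ?_
  · rintro (x | j) hv hne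
    · have : x = 1 := by
        fin_cases x
        · simp at hne
        · rfl
      subst this
      simp [edgeTree, he.symm]
    · obtain ⟨x, hx⟩ : ∃ x, f j = some x := by simpa [edgeTree] using hv
      have : x.val < 2 := x.isLt
      have hj : j ∈ {j | ∃ x, f j = some x} := ⟨x, hx⟩
      simp only [edgeTree, crossSubgraph_adj_inr_inl hG, Sum.elim_inr, Sum.elim_inl, hx]
      refine ⟨⟨Set.mem_univ _, hj, rfl⟩, ?_⟩
      simp only [Option.getD_some]
      omega
  · rintro (x | j) (y | k) h
    · have := h.adj_sub.ne
      fin_cases x <;> fin_cases y <;> simp_all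
    · simp_all [edgeTree, crossSubgraph_adj_inl_inr hG]
    · simp_all [edgeTree, crossSubgraph_adj_inr_inl hG]
    · simp [edgeTree] at h

theorem doubleStar_mem_subtrees [Finite ι] (hG : IsTwoBipartite G) (i : ι)
    (f : {j // j ≠ i} → Option (Fin 2)) : doubleStar G i f ∈ subtrees G := by
  classical
  have hroot : ∀ x, (doubleStar G i f).Adj (.inl x) (.inr i) := fun x =>
    (doubleStar_adj hG).2 (.inl rfl)
  have hadj : ∀ x j, (doubleStar G i f).Adj (.inl x) (.inr j) → j = i ∨
      j ≠ i ∧ (if h : j ≠ i then (f ⟨j, h⟩).getD 0 else 0) = x := by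
    intro x j h
    rcases (doubleStar_adj hG).1 h with h | ⟨h, hx⟩
    · exact .inl h
    · exact .inr ⟨h, by simp [h, hx]⟩
  refine isTree_coe_of_parent _ (.inr i) ((doubleStar G i f).edge_vert (hroot 0).symm)
    (Sum.elim (fun _ => .inr i) (fun j => .inl (if h : j ≠ i then (f ⟨j, h⟩).getD 0 else 0)))
    (Sum.elim (fun _ => 1) (fun j => if j = i then 0 else 2)) ?_ ?_
  · rintro (x | j) hv hne
    · simpa using hroot x
    · have hj : j ≠ i := fun h => hne (by rw [h])
      obtain ⟨x, hx⟩ : ∃ x, doubleStarRel i f j x := hv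
      have h1 := (doubleStar_adj hG).2 hx
      rcases hadj _ _ h1 with h2 | ⟨-, h2⟩
      · exact absurd h2 hj
      · rw [Sum.elim_inr, h2]
        exact ⟨h1.symm, by simp [hj]⟩
  · rintro (x | j) (y | k) h
    · simp [doubleStar] at h
    · rcases hadj _ _ h with h2 | ⟨h1, h2⟩
      · left; simp [h2]
      · right; exact ⟨by simpa using h1, by rw [Sum.elim_inr, h2]⟩
    · rcases hadj _ _ h.symm with h2 | ⟨h1, h2⟩
      · right; simp [h2]
      · left; exact ⟨by simpa using h1, by rw [Sum.elim_inr, h2]⟩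
    · simp [doubleStar] at h

theorem edgeTree_adj (he : G.Adj (.inl 0) (.inl 1)) (f : ι → Option (Fin 2)) :
    (edgeTree G f).Adj (.inl 0) (.inl 1) := by
  simp [edgeTree, he]

theorem not_noEdgeTree_adj (c) : ¬ (noEdgeTree G c).Adj (.inl 0) (.inl 1) := by
  rcases c with i | ⟨x, f⟩ | ⟨i, f⟩ <;>
    simp [noEdgeTree, leafTree, starTree, doubleStar]

theorem noEdgeTree_mem_subtrees [Finite ι] (hG : IsTwoBipartite G) (c) :
    noEdgeTree G c ∈ subtrees G := by
  rcases c with i | ⟨x, f⟩ | ⟨i, f⟩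
  · exact leafTree_mem_subtrees i
  · exact starTree_mem_subtrees hG x f
  · exact doubleStar_mem_subtrees hG i f

theorem exists_leafTree_eq (hG : IsTwoBipartite G) {T : G.Subgraph} (hT : T ∈ subtrees G)
    (h : ∀ x, .inl x ∉ T.verts) : ∃ i, leafTree G i = T := by
  have hT' : T.coe.Connected := hT.connected
  obtain ⟨⟨v, hv⟩⟩ := hT'.nonempty
  obtain ⟨i, rfl⟩ : ∃ i, v = .inr i := by
    rcases v with x | i
    · exact absurd hv (h x)
    · exact ⟨i, rfl⟩
  refine ⟨i, (eq_crossSubgraph hG T ?_ ?_ ?_ ?_).symm⟩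
  · simpa using h
  · intro j
    refine ⟨fun hj => ?_, fun hj => ?_⟩
    · by_contra hji
      obtain ⟨w, hw⟩ := exists_neighbor_of_connected hT' hj hv
        (fun e => hji (Sum.inr_injective e))
      rcases w with x | k
      · exact h x (T.edge_vert hw.symm)
      · exact hG.not_adj_inr _ _ hw.adj_sub
    · rw [Set.mem_singleton_iff] at hj
      rwa [hj]
  · simp
  · simpa using fun h' => h 0 (T.edge_vert h')

theorem exists_starTree_eq (hG : IsTwoBipartite G) {T : G.Subgraph} (hT : T ∈ subtrees G)
    {x : Fin 2} (hx : .inl x ∈ T.verts) (h : ∀ y, .inl y ∈ T.verts → y = x) :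
    ∃ f, starTree G x f = T := by
  classical
  have hT' : T.coe.Connected := hT.connected
  refine ⟨fun j => decide (.inr j ∈ T.verts), (eq_crossSubgraph hG T ?_ ?_ ?_ ?_).symm⟩
  · exact fun y => ⟨fun hy => h y hy, fun hy => by rw [Set.mem_singleton_iff] at hy; rwa [hy]⟩
  · simp
  · rintro y hy j hj
    rw [Set.mem_singleton_iff] at hy
    subst hy
    have hj' : .inr j ∈ T.verts := by simpa using hj
    simp only [iff_true]
    obtain ⟨w, hw⟩ := exists_neighbor_of_connected hT' hj' hx (by simp)
    rcases w with z | k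
    · rw [← h z (T.edge_vert hw.symm)]
      exact hw.symm
    · exact absurd hw.adj_sub (hG.not_adj_inr _ _)
  · simp only [and_false, iff_false]
    intro h'
    have := (h 0 (T.edge_vert h')).trans (h 1 (T.edge_vert h'.symm)).symm
    simp at this

/-- The vertex of `Fin 2` adjacent to `inr j` in `T`, when there is one. -/
def attachment (T : G.Subgraph) (j : ι) : Option (Fin 2) := by
  classical
  exact if T.Adj (.inl 0) (.inr j) then some 0 else if T.Adj (.inl 1) (.inr j) then some 1 else none

theorem attachment_eq_some_iff {T : G.Subgraph} {j : ι}
    (h : ¬ (T.Adj (.inl 0) (.inr j) ∧ T.Adj (.inl 1) (.inr j))) {x : Fin 2} :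
    attachment T j = some x ↔ T.Adj (.inl x) (.inr j) := by
  rw [not_and] at h
  unfold attachment
  fin_cases x <;> by_cases h0 : T.Adj (.inl 0) (.inr j) <;> simp_all

theorem inr_mem_verts_iff (hG : IsTwoBipartite G) {T : G.Subgraph} (hT : T.coe.Connected)
    (h : ∃ x, .inl x ∈ T.verts) {j : ι} :
    .inr j ∈ T.verts ↔ ∃ x, T.Adj (.inl x) (.inr j) := by
  refine ⟨fun hj => ?_, fun ⟨x, hx⟩ => T.edge_vert hx.symm⟩
  obtain ⟨x, hx⟩ := h
  obtain ⟨w, hw⟩ := exists_neighbor_of_connected hT hj hx (by simp)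
  rcases w with z | k
  · exact ⟨z, hw.symm⟩
  · exact absurd hw.adj_sub (hG.not_adj_inr _ _)

theorem exists_edgeTree_eq (hG : IsTwoBipartite G) {T : G.Subgraph} (hT : T ∈ subtrees G)
    (h : T.Adj (.inl 0) (.inl 1)) : ∃ f, edgeTree G f = T := by
  have key : ∀ j x, attachment T j = some x ↔ T.Adj (.inl x) (.inr j) := fun j x =>
    attachment_eq_some_iff fun h' => not_adj_of_common_neighbor hT.isAcyclic h'.1 h'.2.symm h
  have hx : ∀ x, .inl x ∈ T.verts :=
    Fin.forall_fin_two.2 ⟨T.edge_vert h, T.edge_vert h.symm⟩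
  refine ⟨attachment T, (eq_crossSubgraph hG T ?_ ?_ ?_ ?_).symm⟩
  · simpa using hx
  · intro j
    simp only [Set.mem_ofPred_eq, key]
    exact inr_mem_verts_iff hG hT.connected ⟨0, hx 0⟩
  · exact fun x _ j _ => (key j x).symm
  · simp [h, h.adj_sub]

theorem exists_doubleStar_eq (hG : IsTwoBipartite G) {T : G.Subgraph} (hT : T ∈ subtrees G)
    (hx : ∀ x, .inl x ∈ T.verts) (h : ¬ T.Adj (.inl 0) (.inl 1)) :
    ∃ i f, doubleStar G i f = T := by
  obtain ⟨i, hi0, hi1⟩ : ∃ i, T.Adj (.inl 0) (.inr i) ∧ T.Adj (.inl 1) (.inr i) := by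
    obtain ⟨u, v, huv, hu, hv⟩ := exists_adj_of_connected hT.connected
      {v | v = .inl 0 ∨ T.Adj (.inl 0) v} (hx 0) (hx 1) (.inl rfl) (by simpa using h)
    simp only [Set.mem_ofPred_eq, not_or] at hu hv
    rcases hu with rfl | hu
    · exact absurd huv hv.2
    rcases u with x | i
    · fin_cases x
      · exact absurd hu (not_adj_self T _)
      · exact absurd hu h
    · rcases v with y | k
      · fin_cases y
        · exact absurd rfl hv.1
        · exact ⟨i, hu, huv.symm⟩
      · exact absurd huv.adj_sub (hG.not_adj_inr _ _)
  have key : ∀ j x, doubleStarRel i (fun j => attachment T j.1) j x ↔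
      T.Adj (.inl x) (.inr j) := by
    intro j x
    by_cases hj : j = i
    · subst hj
      simp only [doubleStarRel, true_or, true_iff]
      exact Fin.forall_fin_two (p := fun x => T.Adj (.inl x) (.inr j)).2 ⟨hi0, hi1⟩ x
    · simp only [doubleStarRel, hj, false_or, ne_eq, not_false_eq_true, exists_true_left]
      refine attachment_eq_some_iff fun h' => hj ?_
      exact Sum.inr_injective (common_neighbor_unique hT.isAcyclic (by simp) h'.1 h'.2.symm
        hi0 hi1.symm)
  refine ⟨i, fun j => attachment T j.1, (eq_crossSubgraph hG T ?_ ?_ ?_ ?_).symm⟩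
  · simpa using hx
  · intro j
    simp only [Set.mem_ofPred_eq, key]
    exact inr_mem_verts_iff hG hT.connected ⟨0, hx 0⟩
  · exact fun x _ j _ => (key j x).symm
  · simp [h]

theorem exists_noEdgeTree_eq (hG : IsTwoBipartite G) {T : G.Subgraph} (hT : T ∈ subtrees G)
    (h : ¬ T.Adj (.inl 0) (.inl 1)) : ∃ c, noEdgeTree G c = T := by
  by_cases hx : ∀ x, .inl x ∈ T.verts
  · obtain ⟨i, f, hf⟩ := exists_doubleStar_eq hG hT hx h
    exact ⟨.inr (.inr ⟨i, f⟩), hf⟩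
  by_cases hy : ∀ x, .inl x ∉ T.verts
  · obtain ⟨i, hi⟩ := exists_leafTree_eq hG hT hy
    exact ⟨.inl i, hi⟩
  push Not at hx hy
  obtain ⟨x, hx⟩ := hx
  obtain ⟨y, hy⟩ := hy
  obtain ⟨f, hf⟩ := exists_starTree_eq hG hT hy fun z hz => by
    have : z ≠ x := fun e => hx (e ▸ hz)
    have : y ≠ x := fun e => hx (e ▸ hy)
    omega
  exact ⟨.inr (.inl (y, f)), hf⟩

theorem subtrees_eq_of_not_adj [Finite ι] (hG : IsTwoBipartite G)
    (he : ¬ G.Adj (.inl 0) (.inl 1)) : subtrees G = Set.range (noEdgeTree G) := by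
  ext T
  exact ⟨fun hT => exists_noEdgeTree_eq hG hT fun h => he h.adj_sub,
    fun ⟨c, hc⟩ => hc ▸ noEdgeTree_mem_subtrees hG c⟩

theorem subtrees_eq_of_adj [Finite ι] (hG : IsTwoBipartite G) (he : G.Adj (.inl 0) (.inl 1)) :
    subtrees G = Set.range (noEdgeTree G) ∪ Set.range (edgeTree G) := by
  ext T
  constructor
  · intro hT
    by_cases h : T.Adj (.inl 0) (.inl 1)
    · exact .inr (exists_edgeTree_eq hG hT h)
    · exact .inl (exists_noEdgeTree_eq hG hT h)
  · rintro (⟨c, rfl⟩ | ⟨f, rfl⟩)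
    · exact noEdgeTree_mem_subtrees hG c
    · exact edgeTree_mem_subtrees hG he f

theorem disjoint_range_noEdgeTree_range_edgeTree (he : G.Adj (.inl 0) (.inl 1)) :
    Disjoint (Set.range (noEdgeTree G)) (Set.range (edgeTree G)) := by
  rw [Set.disjoint_left]
  rintro _ ⟨c, rfl⟩ ⟨f, hf⟩
  exact not_noEdgeTree_adj c (hf ▸ edgeTree_adj he f)

end Classification

section Counting

theorem sum_sum_apply {ι κ : Type*} [Fintype ι] [DecidableEq ι] [Fintype κ] (w : κ → ℝ) :
    ∑ f : ι → κ, ∑ j, w (f j) =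
      Fintype.card ι * ((Fintype.card κ : ℝ) ^ (Fintype.card ι - 1) * ∑ b, w b) := by
  rw [Finset.sum_comm]
  have : ∀ j : ι, ∑ f : ι → κ, w (f j) =
      (Fintype.card κ : ℝ) ^ (Fintype.card ι - 1) * ∑ b, w b := by
    intro j
    have := Fintype.sum_piFinset_apply w Finset.univ j
    simpa [Fintype.piFinset_univ] using this
  simp [this]

theorem cast_ncard_setOf {ι : Type*} [Fintype ι] (p : ι → Prop) [DecidablePred p] :
    ({j | p j}.ncard : ℝ) = ∑ j, if p j then 1 else 0 := by
  rw [Set.ncard_eq_toFinset_card']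
  simp

variable {ι : Type*} [Fintype ι] [DecidableEq ι] {G : SimpleGraph (Fin 2 ⊕ ι)}

theorem sum_ncard_starTree (x : Fin 2) :
    ∑ f : ι → Bool, ((starTree G x f).verts.ncard : ℝ) =
      2 ^ Fintype.card ι + Fintype.card ι * 2 ^ (Fintype.card ι - 1) := by
  have : ∀ f : ι → Bool, ((starTree G x f).verts.ncard : ℝ) =
      1 + ∑ j, if f j = true then 1 else 0 := by
    intro f
    rw [starTree, ncard_verts_crossSubgraph, Nat.cast_add, cast_ncard_setOf]
    simp
  simp_rw [this]
  rw [Finset.sum_add_distrib, sum_sum_apply (fun b : Bool => if b = true then (1 : ℝ) else 0)]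
  simp

theorem sum_ite_isSome :
    ∑ b : Option (Fin 2), (if b.isSome = true then (1 : ℝ) else 0) = 2 := by
  rw [Fintype.sum_option]
  simp

theorem sum_ncard_edgeTree :
    ∑ f : ι → Option (Fin 2), ((edgeTree G f).verts.ncard : ℝ) =
      2 * 3 ^ Fintype.card ι + Fintype.card ι * (3 ^ (Fintype.card ι - 1) * 2) := by
  have : ∀ f : ι → Option (Fin 2), ((edgeTree G f).verts.ncard : ℝ) =
      2 + ∑ j, if (f j).isSome = true then 1 else 0 := by
    intro f
    rw [edgeTree, ncard_verts_crossSubgraph, Nat.cast_add, ← cast_ncard_setOf]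
    simp [Option.isSome_iff_exists]
  simp_rw [this]
  rw [Finset.sum_add_distrib,
    sum_sum_apply (fun b : Option (Fin 2) => if b.isSome = true then (1 : ℝ) else 0),
    sum_ite_isSome]
  simp
  ring

theorem sum_ncard_doubleStar (i : ι) :
    ∑ f : {j // j ≠ i} → Option (Fin 2), ((doubleStar G i f).verts.ncard : ℝ) =
      3 * 3 ^ (Fintype.card ι - 1) +
        (Fintype.card ι - 1 : ℕ) * (3 ^ (Fintype.card ι - 1 - 1) * 2) := by
  have : ∀ f : {j // j ≠ i} → Option (Fin 2), ((doubleStar G i f).verts.ncard : ℝ) =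
      3 + ∑ j, if (f j).isSome = true then 1 else 0 := by
    intro f
    have hB : {j | ∃ x, doubleStarRel i f j x} =
        insert i (Subtype.val '' {j | (f j).isSome = true}) := by
      ext j
      by_cases hj : j = i <;>
        simp [doubleStarRel, hj, Option.isSome_iff_exists]
    rw [doubleStar, ncard_verts_crossSubgraph, Nat.cast_add, ← cast_ncard_setOf, hB,
      Set.ncard_insert_of_notMem (by simp), Set.ncard_image_of_injective _ Subtype.val_injective]
    simp
    ring
  have hcard : Fintype.card {j // j ≠ i} = Fintype.card ι - 1 := by
    simp [Fintype.card_subtype_compl]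
  simp_rw [this]
  rw [Finset.sum_add_distrib,
    sum_sum_apply (fun b : Option (Fin 2) => if b.isSome = true then (1 : ℝ) else 0),
    sum_ite_isSome, hcard]
  simp [hcard]
  ring

theorem finsum_ncard_noEdgeTree (hG : IsTwoBipartite G) :
    ∑ᶠ T ∈ Set.range (noEdgeTree G), (T.verts.ncard : ℝ) =
      Fintype.card ι + (2 * (2 ^ Fintype.card ι + Fintype.card ι * 2 ^ (Fintype.card ι - 1)) +
        Fintype.card ι * (3 * 3 ^ (Fintype.card ι - 1) +
          (Fintype.card ι - 1 : ℕ) * (3 ^ (Fintype.card ι - 1 - 1) * 2))) := by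
  rw [finsum_mem_range (noEdgeTree_injective hG), finsum_eq_sum_of_fintype, Fintype.sum_sum_type,
    Fintype.sum_sum_type, Fintype.sum_prod_type, Fintype.sum_sigma]
  simp only [noEdgeTree, Sum.elim_inl, Sum.elim_inr, sum_ncard_starTree, sum_ncard_doubleStar]
  simp [leafTree, ncard_verts_crossSubgraph]
  ring

theorem ncard_range_noEdgeTree (hG : IsTwoBipartite G) :
    (Set.range (noEdgeTree G)).ncard =
      Fintype.card ι + (2 * 2 ^ Fintype.card ι + Fintype.card ι * 3 ^ (Fintype.card ι - 1)) := by
  rw [Set.ncard_range_of_injective (noEdgeTree_injective hG), Nat.card_eq_fintype_card]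
  simp [Fintype.card_subtype_compl]

theorem finsum_ncard_edgeTree (hG : IsTwoBipartite G) :
    ∑ᶠ T ∈ Set.range (edgeTree G), (T.verts.ncard : ℝ) =
      2 * 3 ^ Fintype.card ι + Fintype.card ι * (3 ^ (Fintype.card ι - 1) * 2) := by
  rw [finsum_mem_range (edgeTree_injective hG), finsum_eq_sum_of_fintype, sum_ncard_edgeTree]

theorem ncard_range_edgeTree (hG : IsTwoBipartite G) :
    (Set.range (edgeTree G)).ncard = 3 ^ Fintype.card ι := by
  rw [Set.ncard_range_of_injective (edgeTree_injective hG), Nat.card_eq_fintype_card]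
  simp

theorem two_pow_mul_lt_mul_three_pow (k : ℕ) :
    ((k : ℝ) + 6) * (1 + 2 * (k + 6) / 3) + 2 ^ (k + 7) * (1 + (k + 6) / 6) <
      (k + 6) * 3 ^ (k + 4) := by
  induction k with
  | zero => norm_num
  | succ k ih =>
    have h2 : (1 : ℝ) ≤ 2 ^ (k + 7) := one_le_pow₀ (by norm_num)
    have h3 : (0 : ℝ) < 3 ^ (k + 4) := by positivity
    have hk : (0 : ℝ) ≤ k := by positivity
    rw [show (2 : ℝ) ^ (k + 1 + 7) = 2 * 2 ^ (k + 7) by ring,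
      show (3 : ℝ) ^ (k + 1 + 4) = 3 * 3 ^ (k + 4) by ring]
    push_cast
    nlinarith [mul_nonneg hk hk, mul_nonneg hk (sub_nonneg.2 h2)]

end Counting

theorem isTwoBipartite_completeBipartiteGraph (ι : Type*) :
    IsTwoBipartite (completeBipartiteGraph (Fin 2) ι) where
  adj_inl_inr := by simp
  not_adj_inr := by simp

theorem isTwoBipartite_Hgraph (n : ℕ) : IsTwoBipartite (Hgraph n) where
  adj_inl_inr := by simp [Hgraph, addEdge]
  not_adj_inr := by simp [Hgraph, addEdge]

theorem Hgraph_adj (n : ℕ) : (Hgraph n).Adj (.inl 0) (.inl 1) := by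
  simp [Hgraph, addEdge]

/-- For `n ≥ 8`, joining the two vertices in the partite set of cardinality `2`
of `K_{2,n-2}` decreases the mean subtree order. -/
theorem mu_Hgraph_lt_mu_completeBipartite (n : ℕ) (hn : 8 ≤ n) :
    mu (Hgraph n) < mu (completeBipartiteGraph (Fin 2) (Fin (n - 2))) := by
  obtain ⟨k, rfl⟩ := Nat.exists_eq_add_of_le' hn
  have hK := isTwoBipartite_completeBipartiteGraph (Fin (k + 8 - 2))
  have hH := isTwoBipartite_Hgraph (k + 8)
  have he := Hgraph_adj (k + 8)
  have hdisj := disjoint_range_noEdgeTree_range_edgeTree he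
  rw [mu, mu, numSubtrees, numSubtrees, subtrees_eq_of_not_adj hK (by simp),
    subtrees_eq_of_adj hH he, Set.ncard_union_eq hdisj (Set.finite_range _) (Set.finite_range _),
    finsum_mem_union hdisj (Set.finite_range _) (Set.finite_range _),
    finsum_ncard_noEdgeTree hK, finsum_ncard_noEdgeTree hH, finsum_ncard_edgeTree hH,
    ncard_range_noEdgeTree hK, ncard_range_noEdgeTree hH, ncard_range_edgeTree hH,
    Fintype.card_fin, show k + 8 - 2 = k + 6 by omega, show k + 6 - 1 = k + 5 by omega,
    show k + 5 - 1 = k + 4 by omega]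
  push_cast
  have key := two_pow_mul_lt_mul_three_pow k
  have h3 : (0 : ℝ) < 3 ^ (k + 4) := by positivity
  rw [div_lt_div_iff₀ (by positivity) (by positivity)]
  rw [show (3 : ℝ) ^ (k + 6) = 9 * 3 ^ (k + 4) by ring,
    show (3 : ℝ) ^ (k + 5) = 3 * 3 ^ (k + 4) by ring,
    show (2 : ℝ) ^ (k + 6) = 2 ^ (k + 7) / 2 by ring,
    show (2 : ℝ) ^ (k + 5) = 2 ^ (k + 7) / 4 by ring]
  have := mul_pos h3 (sub_pos.2 key)
  nlinarith [this]

end SubtreePaper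
end
end

section
/- For n ≥ 8, let H_n be the graph obtained from the complete bipartite graph K_{2,n−2} by adding the edge between the two vertices of the partite set of cardinality 2. Then the difference μ(K_{2,n−2}) − μ(H_n) tends to 0 as n tends to infinity. -/
open Filter Topology

noncomputable section

namespace SubtreePaper

section

open Finset

/-- Functions into `Fin 3` vanishing on `A`. -/
def vanishingOn {β : Type*} [Fintype β] [DecidableEq β] (A : Finset β) : Finset (β → Fin 3) :=
  Fintype.piFinset fun j => if j ∈ A then {0} else univ

lemma mem_vanishingOn {β : Type*} [Fintype β] [DecidableEq β] {A : Finset β} {c : β → Fin 3} :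
    c ∈ vanishingOn A ↔ ∀ j ∈ A, c j = 0 := by
  simp only [vanishingOn, Fintype.mem_piFinset]
  refine forall_congr' fun j => ?_
  split_ifs with h <;> simp [h]

lemma card_vanishingOn {β : Type*} [Fintype β] [DecidableEq β] (A : Finset β) :
    (vanishingOn A).card = 3 ^ Aᶜ.card := by
  simp only [vanishingOn, Fintype.card_piFinset, apply_ite Finset.card, card_singleton,
    Finset.card_univ, Fintype.card_fin, prod_ite, prod_const_one, one_mul, prod_const]
  congr 2
  ext; simp

lemma sum_card_ne_zero_vanishingOn {β : Type*} [Fintype β] [DecidableEq β] (A : Finset β) :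
    3 * ∑ c ∈ vanishingOn A, #{j | c j ≠ 0} = 2 * #Aᶜ * #(vanishingOn A) := by
  set d : β → Fin 3 := fun j => if j ∈ A then 0 else 1 with hd
  have hshift (f : (β → Fin 3) → ℕ) :
      ∑ c ∈ vanishingOn A, f (c + d) = ∑ c ∈ vanishingOn A, f c := by
    refine sum_bijective (· + d) (Equiv.addRight d).bijective (fun c => ?_) fun _ _ => rfl
    simp only [mem_vanishingOn]
    refine forall₂_congr fun j hj => ?_
    simp [hd, hj]
  have hpt : ∀ c ∈ vanishingOn A,
      #{j | c j ≠ 0} + #{j | (c + d) j ≠ 0} + #{j | (c + d + d) j ≠ 0} = 2 * #Aᶜ := by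
    intro c hc
    rw [mem_vanishingOn] at hc
    have hA : #Aᶜ = ∑ j, if j ∈ A then 0 else 1 := by
      have : Aᶜ = ({j | j ∉ A} : Finset β) := by ext; simp
      rw [this, card_filter]
      simp only [ite_not]
    rw [hA]
    simp only [card_filter, ← sum_add_distrib, mul_sum]
    refine sum_congr rfl fun j _ => ?_
    by_cases hj : j ∈ A
    · simp [hd, hj, hc j hj]
    · simp only [Pi.add_apply, hd, hj, if_false]
      generalize c j = x
      fin_cases x <;> decide
  have h := sum_congr rfl hpt
  rw [sum_add_distrib, sum_add_distrib, hshift (fun c => #{j | (c + d) j ≠ 0}),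
    hshift (fun c => #{j | c j ≠ 0}), sum_const, smul_eq_mul] at h
  linarith

variable {β : Type*} {G : SimpleGraph (Fin 2 ⊕ β)}

lemma ncard_edgeSet_add [Finite β] (hG : ∀ j k, ¬ G.Adj (Sum.inr j) (Sum.inr k)) (T : G.Subgraph)
    [Decidable (T.Adj (Sum.inl 0) (Sum.inl 1))] :
    T.edgeSet.ncard = {j | T.Adj (Sum.inl 0) (Sum.inr j)}.ncard +
      {j | T.Adj (Sum.inl 1) (Sum.inr j)}.ncard +
      if T.Adj (Sum.inl 0) (Sum.inl 1) then 1 else 0 := by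
  have hset : T.edgeSet =
      ((fun j : β => s(Sum.inl 0, Sum.inr j)) '' {j | T.Adj (Sum.inl 0) (Sum.inr j)} ∪
        (fun j : β => s(Sum.inl 1, Sum.inr j)) '' {j | T.Adj (Sum.inl 1) (Sum.inr j)}) ∪
      if T.Adj (Sum.inl 0) (Sum.inl 1) then {s(Sum.inl 0, Sum.inl 1)} else ∅ := by
    ext e
    induction e using Sym2.ind with | h u v =>
    have h00 (x) : ¬ T.Adj x x := T.loopless.irrefl x
    have hT (j k) : ¬ T.Adj (Sum.inr j) (Sum.inr k) := fun h => hG j k h.adj_sub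
    rcases u with i | j <;> rcases v with i' | j' <;> (try fin_cases i) <;> (try fin_cases i') <;>
      split_ifs with h01 <;>
      simp [h00, hT, h01, T.adj_comm (Sum.inl _) (Sum.inl 0), T.adj_comm (Sum.inr _) (Sum.inl _)]
  rw [hset, Set.ncard_union_eq, Set.ncard_union_eq, Set.ncard_image_of_injective,
    Set.ncard_image_of_injective]
  · split_ifs <;> simp
  · intro j k h; simpa using h
  · intro j k h; simpa using h
  · rw [Set.disjoint_left]; rintro _ ⟨j, -, rfl⟩ ⟨k, -, h⟩; simp at h
  · split_ifs
    · rw [Set.disjoint_left]; rintro _ (⟨j, -, rfl⟩ | ⟨j, -, rfl⟩) h <;> simp at h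
    · simp

lemma ncard_verts {U : Set (Fin 2 ⊕ β)} [Finite β] (h : ∀ i, Sum.inl i ∈ U) :
    U.ncard = {j | Sum.inr j ∈ U}.ncard + 2 := by
  have : U = Sum.inl '' Set.univ ∪ Sum.inr '' {j | Sum.inr j ∈ U} := by
    ext (i | j) <;> simp [h]
  conv_lhs => rw [this]
  rw [Set.ncard_union_eq, Set.ncard_image_of_injective _ Sum.inl_injective,
    Set.ncard_image_of_injective _ Sum.inr_injective]
  · simp [Set.ncard_univ, add_comm]
  · rw [Set.disjoint_left]; rintro _ ⟨i, -, rfl⟩ ⟨j, -, h⟩; simp at h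

lemma isTree_coe_iff [Finite β] (hG : ∀ j k, ¬ G.Adj (Sum.inr j) (Sum.inr k)) (T : G.Subgraph)
    [Decidable (T.Adj (Sum.inl 0) (Sum.inl 1))] (hT : ∀ i, Sum.inl i ∈ T.verts) :
    T.coe.IsTree ↔
      (∀ j, Sum.inr j ∈ T.verts → T.Adj (Sum.inl 0) (Sum.inr j) ∨ T.Adj (Sum.inl 1) (Sum.inr j)) ∧
      {j | T.Adj (Sum.inl 0) (Sum.inr j) ∧ T.Adj (Sum.inl 1) (Sum.inr j)}.ncard +
        (if T.Adj (Sum.inl 0) (Sum.inl 1) then 1 else 0) = 1 := by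
  rw [SimpleGraph.isTree_iff_connected_and_card]
  have hcard (hcov : ∀ j, Sum.inr j ∈ T.verts →
      T.Adj (Sum.inl 0) (Sum.inr j) ∨ T.Adj (Sum.inl 1) (Sum.inr j)) :
      Nat.card T.coe.edgeSet + 1 = Nat.card T.verts ↔
      {j | T.Adj (Sum.inl 0) (Sum.inr j) ∧ T.Adj (Sum.inl 1) (Sum.inr j)}.ncard +
        (if T.Adj (Sum.inl 0) (Sum.inl 1) then 1 else 0) = 1 := by
    have hE : Nat.card T.coe.edgeSet = T.edgeSet.ncard := by
      rw [← T.image_coe_edgeSet_coe, Set.ncard_image_of_injective _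
        (Sym2.map.injective Subtype.val_injective)]; rfl
    have hV : {j | Sum.inr j ∈ T.verts} =
        {j | T.Adj (Sum.inl 0) (Sum.inr j)} ∪ {j | T.Adj (Sum.inl 1) (Sum.inr j)} := by
      ext j
      exact ⟨hcov j, fun h => h.elim (fun h => h.snd_mem) fun h => h.snd_mem⟩
    have := Set.ncard_union_add_ncard_inter {j | T.Adj (Sum.inl 0) (Sum.inr j)}
      {j | T.Adj (Sum.inl 1) (Sum.inr j)}
    rw [hE, ncard_edgeSet_add hG, Nat.card_coe_set_eq, ncard_verts hT, hV, Set.ofPred_and]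
    change _ ↔
      ({j | T.Adj (Sum.inl 0) (Sum.inr j)} ∩ {j | T.Adj (Sum.inl 1) (Sum.inr j)}).ncard + _ = 1
    omega
  constructor
  · rintro ⟨hc, hn⟩
    have hcov : ∀ j, Sum.inr j ∈ T.verts →
        T.Adj (Sum.inl 0) (Sum.inr j) ∨ T.Adj (Sum.inl 1) (Sum.inr j) := by
      intro j hj
      have : Nontrivial T.verts := ⟨⟨⟨_, hT 0⟩, ⟨_, hT 1⟩, by simp⟩⟩
      obtain ⟨⟨u, hu⟩, hju⟩ := hc.preconnected.exists_adj_of_nontrivial ⟨_, hj⟩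
      rw [SimpleGraph.Subgraph.coe_adj] at hju
      rcases u with i | k
      · fin_cases i
        · exact .inl hju.symm
        · exact .inr hju.symm
      · exact (hG _ _ hju.adj_sub).elim
    exact ⟨hcov, (hcard hcov).1 hn⟩
  · rintro ⟨hcov, hn⟩
    refine ⟨?_, (hcard hcov).2 hn⟩
    have hadj {u v} (h : T.Adj u v) : T.coe.Reachable ⟨u, h.fst_mem⟩ ⟨v, h.snd_mem⟩ :=
      SimpleGraph.Adj.reachable (G := T.coe) h
    have h01 : T.coe.Reachable ⟨_, hT 0⟩ ⟨_, hT 1⟩ := by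
      split_ifs at hn with h
      · exact hadj h
      · obtain ⟨j, hj⟩ := Set.ncard_eq_one.1 hn
        obtain ⟨h0, h1⟩ := (Set.ext_iff.1 hj j).2 rfl
        exact (hadj h0).trans (hadj h1).symm
    rw [SimpleGraph.connected_iff_exists_forall_reachable]
    refine ⟨⟨_, hT 0⟩, ?_⟩
    rintro ⟨i | j, hv⟩
    · fin_cases i
      · exact .refl _
      · exact h01
    · rcases hcov j hv with h | h
      · exact hadj h
      · exact h01.trans (hadj h)

/-- The subgraph of `G` containing both hubs `Sum.inl 0`, `Sum.inl 1`, in which the hub `i` is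
joined to the leaf `j` when `r i j`, and the hubs are joined when `e`. -/
def hubSubgraph (G : SimpleGraph (Fin 2 ⊕ β)) (r : Fin 2 → β → Prop) (e : Prop)
    (_hr : ∀ i j, r i j → G.Adj (Sum.inl i) (Sum.inr j)) : G.Subgraph where
  verts := {v | ∀ j, v = Sum.inr j → r 0 j ∨ r 1 j}
  Adj u v := G.Adj u v ∧ match u, v with
    | .inl _, .inl _ => e
    | .inl i, .inr j => r i j
    | .inr j, .inl i => r i j
    | .inr _, .inr _ => False
  adj_sub h := h.1
  edge_vert := by
    rintro (i | j) (i' | j') ⟨-, h⟩ k hk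
    · cases hk
    · cases hk
    · cases hk
      fin_cases i'
      · exact .inl h
      · exact .inr h
    · exact h.elim
  symm := ⟨by
    rintro (i | j) (i' | j') ⟨h, h'⟩ <;> exact ⟨h.symm, h'⟩⟩

section hubSubgraph

variable {r : Fin 2 → β → Prop} {e : Prop} {hr : ∀ i j, r i j → G.Adj (Sum.inl i) (Sum.inr j)}

lemma inl_mem_hubSubgraph (i : Fin 2) : Sum.inl i ∈ (hubSubgraph G r e hr).verts :=
  fun _ h => by cases h

lemma inr_mem_hubSubgraph {j : β} :
    Sum.inr j ∈ (hubSubgraph G r e hr).verts ↔ r 0 j ∨ r 1 j :=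
  ⟨fun h => h j rfl, fun h k hk => by cases hk; exact h⟩

lemma hubSubgraph_adj_inl_inr {i : Fin 2} {j : β} :
    (hubSubgraph G r e hr).Adj (Sum.inl i) (Sum.inr j) ↔ r i j :=
  ⟨fun h => h.2, fun h => ⟨hr i j h, h⟩⟩

lemma hubSubgraph_adj_inl_inl :
    (hubSubgraph G r e hr).Adj (Sum.inl 0) (Sum.inl 1) ↔ G.Adj (Sum.inl 0) (Sum.inl 1) ∧ e :=
  Iff.rfl

lemma ncard_verts_hubSubgraph [Finite β] :
    (hubSubgraph G r e hr).verts.ncard = {j | r 0 j ∨ r 1 j}.ncard + 2 := by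
  rw [ncard_verts inl_mem_hubSubgraph]
  simp only [inr_mem_hubSubgraph]

lemma isTree_hubSubgraph_iff [Finite β] (hG : ∀ j k, ¬ G.Adj (Sum.inr j) (Sum.inr k))
    [Decidable (G.Adj (Sum.inl 0) (Sum.inl 1) ∧ e)] :
    (hubSubgraph G r e hr).coe.IsTree ↔ {j | r 0 j ∧ r 1 j}.ncard +
      (if G.Adj (Sum.inl 0) (Sum.inl 1) ∧ e then 1 else 0) = 1 := by
  classical
  rw [isTree_coe_iff hG _ inl_mem_hubSubgraph]
  simp only [hubSubgraph_adj_inl_inr, hubSubgraph_adj_inl_inl, inr_mem_hubSubgraph,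
    imp_self, implies_true, true_and]

lemma eq_hubSubgraph [Finite β] (hG : ∀ j k, ¬ G.Adj (Sum.inr j) (Sum.inr k)) {T : G.Subgraph}
    (hT : T.coe.IsTree) (h0 : Sum.inl 0 ∈ T.verts) (h1 : Sum.inl 1 ∈ T.verts)
    (hTr : ∀ i j, T.Adj (Sum.inl i) (Sum.inr j) ↔ r i j)
    (hTe : T.Adj (Sum.inl 0) (Sum.inl 1) ↔ e) :
    T = hubSubgraph G r e hr := by
  classical
  have hmem : ∀ i, Sum.inl i ∈ T.verts := by intro i; fin_cases i <;> assumption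
  obtain ⟨hcov, -⟩ := (isTree_coe_iff hG T hmem).1 hT
  have h00 (x) : ¬ T.Adj x x := T.loopless.irrefl x
  ext u v
  · rcases u with i | j
    · exact iff_of_true (hmem i) (inl_mem_hubSubgraph i)
    · rw [inr_mem_hubSubgraph, ← hTr, ← hTr]
      exact ⟨hcov j, fun h => h.elim (fun h => h.snd_mem) fun h => h.snd_mem⟩
  · refine ⟨fun h => ⟨h.adj_sub, ?_⟩, fun h => ?_⟩
    · rcases u with i | j <;> rcases v with i' | j'
      · rw [← hTe]
        fin_cases i <;> fin_cases i'
        · exact (h00 _ h).elim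
        · exact h
        · exact h.symm
        · exact (h00 _ h).elim
      · exact (hTr _ _).1 h
      · exact (hTr _ _).1 h.symm
      · exact hG _ _ h.adj_sub
    · rcases u with i | j <;> rcases v with i' | j'
      · have he := hTe.2 h.2
        fin_cases i <;> fin_cases i'
        · exact (G.loopless.irrefl _ h.1).elim
        · exact he
        · exact he.symm
        · exact (G.loopless.irrefl _ h.1).elim
      · exact (hTr _ _).2 h.2
      · exact ((hTr _ _).2 h.2).symm
      · exact h.2.elim

end hubSubgraph

/-- Subtrees of `G` missing one of the two hubs. -/
def hubMissingSubtrees (G : SimpleGraph (Fin 2 ⊕ β)) : Set G.Subgraph :=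
  {T | T ∈ subtrees G ∧ ∃ i, Sum.inl i ∉ T.verts}

/-- Subtrees of `G` containing both hubs, which are not adjacent in the subtree. -/
def hubNonadjSubtrees (G : SimpleGraph (Fin 2 ⊕ β)) : Set G.Subgraph :=
  {T | T ∈ subtrees G ∧ (∀ i, Sum.inl i ∈ T.verts) ∧ ¬ T.Adj (Sum.inl 0) (Sum.inl 1)}

/-- Subtrees of `G` containing the edge between the two hubs. -/
def hubAdjSubtrees (G : SimpleGraph (Fin 2 ⊕ β)) : Set G.Subgraph :=
  {T | T ∈ subtrees G ∧ T.Adj (Sum.inl 0) (Sum.inl 1)}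

lemma adj_of_mem_hubMissingSubtrees (hG : ∀ j k, ¬ G.Adj (Sum.inr j) (Sum.inr k)) {T : G.Subgraph}
    (hT : T ∈ hubMissingSubtrees G) {i : Fin 2} {j : β} (hi : Sum.inl i ∈ T.verts)
    (hj : Sum.inr j ∈ T.verts) : T.Adj (Sum.inl i) (Sum.inr j) := by
  obtain ⟨htree, k, hk⟩ := hT
  have : Nontrivial T.verts := ⟨⟨⟨_, hi⟩, ⟨_, hj⟩, by simp⟩⟩
  obtain ⟨⟨u, hu⟩, hju⟩ := htree.connected.preconnected.exists_adj_of_nontrivial ⟨_, hj⟩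
  rw [SimpleGraph.Subgraph.coe_adj] at hju
  rcases u with i' | j'
  · have h1 : k ≠ i := by rintro rfl; exact hk hi
    have h2 : k ≠ i' := by rintro rfl; exact hk hu
    obtain rfl : i = i' := by omega
    exact hju.symm
  · exact (hG _ _ hju.adj_sub).elim

lemma isInduced_of_mem_hubMissingSubtrees (hG : ∀ j k, ¬ G.Adj (Sum.inr j) (Sum.inr k))
    {T : G.Subgraph} (hT : T ∈ hubMissingSubtrees G) : T.IsInduced := by
  rintro (i | j) hu (i' | j') hv h
  · obtain ⟨-, k, hk⟩ := hT
    have h1 : k ≠ i := by rintro rfl; exact hk hu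
    have h2 : k ≠ i' := by rintro rfl; exact hk hv
    obtain rfl : i = i' := by omega
    exact (G.loopless.irrefl _ h).elim
  · exact adj_of_mem_hubMissingSubtrees hG hT hu hv
  · exact (adj_of_mem_hubMissingSubtrees hG hT hv hu).symm
  · exact (hG _ _ h).elim

lemma ncard_hubMissingSubtrees_le [Fintype β] (hG : ∀ j k, ¬ G.Adj (Sum.inr j) (Sum.inr k)) :
    (hubMissingSubtrees G).ncard ≤ 2 ^ (Fintype.card β + 2) := by
  have hinj : Set.InjOn SimpleGraph.Subgraph.verts (hubMissingSubtrees G) := by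
    intro T hT T' hT' h
    have hi := isInduced_of_mem_hubMissingSubtrees hG hT
    have hi' := isInduced_of_mem_hubMissingSubtrees hG hT'
    refine SimpleGraph.Subgraph.ext h ?_
    ext u v
    exact ⟨fun a => hi' (h ▸ a.fst_mem) (h ▸ a.snd_mem) a.adj_sub,
      fun a => hi (h ▸ a.fst_mem) (h ▸ a.snd_mem) a.adj_sub⟩
  refine (Set.ncard_le_ncard_of_injOn _ (fun _ _ => Set.mem_univ _) hinj).trans ?_
  rw [Set.ncard_univ, Nat.card_eq_fintype_card, Fintype.card_set, Fintype.card_sum,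
    Fintype.card_fin, add_comm]

lemma subtrees_eq_union : subtrees G =
    hubMissingSubtrees G ∪ (hubNonadjSubtrees G ∪ hubAdjSubtrees G) := by
  ext T
  constructor
  · intro h
    by_cases hmem : ∀ i, Sum.inl i ∈ T.verts
    · by_cases he : T.Adj (Sum.inl 0) (Sum.inl 1)
      · exact .inr (.inr ⟨h, he⟩)
      · exact .inr (.inl ⟨h, hmem, he⟩)
    · exact .inl ⟨h, not_forall.1 hmem⟩
  · rintro (h | h | h) <;> exact h.1

section codes

variable [Fintype β] [DecidableEq β]

lemma succ_zero_or_one_iff (x : Fin 3) : (x = Fin.succ 0 ∨ x = Fin.succ (1 : Fin 2)) ↔ x ≠ 0 := by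
  decide +revert

lemma bijOn_hubAdjSubtrees (hub : ∀ i j, G.Adj (Sum.inl i) (Sum.inr j))
    (hG : ∀ j k, ¬ G.Adj (Sum.inr j) (Sum.inr k)) (h01 : G.Adj (Sum.inl 0) (Sum.inl 1)) :
    Set.BijOn (fun c : β → Fin 3 => hubSubgraph G (fun i j => c j = i.succ) True fun i j _ => hub i j)
      (vanishingOn ∅ : Finset (β → Fin 3)) (hubAdjSubtrees G) := by
  classical
  refine ⟨fun c _ => ⟨?_, h01, trivial⟩, fun c _ c' _ h => ?_, fun T ⟨hT, he⟩ => ?_⟩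
  · refine (isTree_hubSubgraph_iff hG).2 ?_
    have : {j | c j = Fin.succ 0 ∧ c j = Fin.succ (1 : Fin 2)} = ∅ := by
      ext j
      simp only [Set.mem_ofPred_eq, Set.mem_empty_iff_false, iff_false]
      rintro ⟨h, h'⟩
      simp [h] at h'
    rw [this, Set.ncard_empty, if_pos ⟨h01, trivial⟩]
  · have key (i : Fin 2) (j : β) : c j = i.succ ↔ c' j = i.succ := by
      rw [← hubSubgraph_adj_inl_inr (G := G) (r := fun i j => c j = i.succ) (e := True)
        (hr := fun i j _ => hub i j), ← hubSubgraph_adj_inl_inr (G := G)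
        (r := fun i j => c' j = i.succ) (e := True) (hr := fun i j _ => hub i j)]
      exact iff_of_eq (congrArg (fun T : G.Subgraph => T.Adj _ _) h)
    funext j
    have h0 := key 0 j
    have h1 := key 1 j
    generalize c j = x at *
    generalize c' j = y at *
    revert x y
    decide
  · have hmem : ∀ i, Sum.inl i ∈ T.verts := by
      intro i; fin_cases i
      · exact he.fst_mem
      · exact he.snd_mem
    obtain ⟨-, hn⟩ := (isTree_coe_iff hG T hmem).1 hT
    simp only [he, if_true, Nat.add_eq_right] at hn
    rw [Set.ncard_eq_zero (Set.toFinite _)] at hn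
    refine ⟨fun j => if T.Adj (Sum.inl 0) (Sum.inr j) then 1 else
      if T.Adj (Sum.inl 1) (Sum.inr j) then 2 else 0, by simp [mem_vanishingOn], ?_⟩
    refine (eq_hubSubgraph hG hT (hmem 0) (hmem 1) (fun i j => ?_) (by simp [he])).symm
    have hj : ¬ (T.Adj (Sum.inl 0) (Sum.inr j) ∧ T.Adj (Sum.inl 1) (Sum.inr j)) :=
      fun h => Set.eq_empty_iff_forall_notMem.1 hn j h
    fin_cases i <;> by_cases a : T.Adj (Sum.inl 0) (Sum.inr j) <;>
      by_cases b : T.Adj (Sum.inl 1) (Sum.inr j) <;> simp_all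

lemma bijOn_hubNonadjSubtrees (hub : ∀ i j, G.Adj (Sum.inl i) (Sum.inr j))
    (hG : ∀ j k, ¬ G.Adj (Sum.inr j) (Sum.inr k)) :
    Set.BijOn (fun x : Σ _ : β, β → Fin 3 =>
        hubSubgraph G (fun i j => j = x.1 ∨ x.2 j = i.succ) False fun i j _ => hub i j)
      (univ.sigma fun v => vanishingOn {v} : Finset (Σ _ : β, β → Fin 3))
      (hubNonadjSubtrees G) := by
  classical
  have inter (v : β) (c : β → Fin 3) : {j | (j = v ∨ c j = Fin.succ 0) ∧
      (j = v ∨ c j = Fin.succ (1 : Fin 2))} = {v} := by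
    ext j
    simp only [Set.mem_ofPred_eq, Set.mem_singleton_iff]
    refine ⟨?_, fun h => ⟨.inl h, .inl h⟩⟩
    rintro ⟨h | h, h' | h'⟩ <;> try assumption
    simp [h] at h'
  refine ⟨fun x _ => ⟨?_, inl_mem_hubSubgraph, fun h => h.2⟩, ?_, fun T ⟨hT, hmem, he⟩ => ?_⟩
  · refine (isTree_hubSubgraph_iff hG).2 ?_
    rw [inter, Set.ncard_singleton, if_neg fun h => h.2]
  · rintro ⟨v, c⟩ hc ⟨v', c'⟩ hc' h
    simp only [mem_coe, mem_sigma, mem_univ, mem_vanishingOn, mem_singleton, forall_eq,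
      true_and] at hc hc'
    have key (i : Fin 2) (j : β) : (j = v ∨ c j = i.succ) ↔ (j = v' ∨ c' j = i.succ) := by
      rw [← hubSubgraph_adj_inl_inr (G := G) (r := fun i j => j = v ∨ c j = i.succ) (e := False)
        (hr := fun i j _ => hub i j), ← hubSubgraph_adj_inl_inr (G := G)
        (r := fun i j => j = v' ∨ c' j = i.succ) (e := False) (hr := fun i j _ => hub i j)]
      exact iff_of_eq (congrArg (fun T : G.Subgraph => T.Adj _ _) h)
    obtain rfl : v = v' := by
      have := inter v c
      simp only [key, inter] at this
      exact (Set.singleton_injective this).symm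
    congr 1
    funext j
    by_cases hj : j = v
    · rw [hj, hc, hc']
    · have h0 := key 0 j
      have h1 := key 1 j
      simp only [hj, false_or] at h0 h1
      generalize c j = x at *
      generalize c' j = y at *
      clear * - h0 h1
      revert x y
      decide
  · obtain ⟨-, hn⟩ := (isTree_coe_iff hG T hmem).1 hT
    simp only [he, if_false, add_zero] at hn
    obtain ⟨v, hv⟩ := Set.ncard_eq_one.1 hn
    have hv (j) : T.Adj (Sum.inl 0) (Sum.inr j) ∧ T.Adj (Sum.inl 1) (Sum.inr j) ↔ j = v :=
      Set.ext_iff.1 hv j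
    refine ⟨⟨v, fun j => if j = v then 0 else if T.Adj (Sum.inl 0) (Sum.inr j) then 1 else
      if T.Adj (Sum.inl 1) (Sum.inr j) then 2 else 0⟩, by simp [mem_vanishingOn], ?_⟩
    refine (eq_hubSubgraph hG hT (hmem 0) (hmem 1) (fun i j => ?_) (by simp [he])).symm
    have hj := hv j
    by_cases hjv : j = v
    · obtain ⟨a, b⟩ := hj.2 hjv
      refine iff_of_true ?_ (.inl hjv)
      fin_cases i <;> assumption
    · rw [← hj] at hjv
      fin_cases i <;> by_cases a : T.Adj (Sum.inl 0) (Sum.inr j) <;>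
        by_cases b : T.Adj (Sum.inl 1) (Sum.inr j) <;> simp_all

end codes

section estimate

variable [Fintype β]

/-- The mean order of the subtrees in `hubNonadjSubtrees G`. -/
def centralOrder (β : Type*) [Fintype β] : ℝ := 2 / 3 * Fintype.card β + 7 / 3

lemma finsum_mem_sub_const {α : Type*} {s : Set α} (hs : s.Finite) (f : α → ℝ) (a : ℝ) :
    ∑ᶠ x ∈ s, (f x - a) = ∑ᶠ x ∈ s, f x - a * s.ncard := by
  rw [finsum_mem_eq_finite_toFinset_sum _ hs, finsum_mem_eq_finite_toFinset_sum _ hs,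
    sum_sub_distrib, sum_const, nsmul_eq_mul, Set.ncard_eq_toFinset_card s hs, mul_comm a]

lemma abs_finsum_hubMissingSubtrees_le (hG : ∀ j k, ¬ G.Adj (Sum.inr j) (Sum.inr k)) :
    |∑ᶠ T ∈ hubMissingSubtrees G, ((T.verts.ncard : ℝ) - centralOrder β)| ≤
      (Fintype.card β + 3) * 2 ^ (Fintype.card β + 2) := by
  have hfin : (hubMissingSubtrees G).Finite := Set.toFinite _
  rw [finsum_mem_eq_finite_toFinset_sum _ hfin]
  refine (abs_sum_le_sum_abs _ _).trans ?_
  have hb : ∀ T ∈ hfin.toFinset, |(T.verts.ncard : ℝ) - centralOrder β| ≤ Fintype.card β + 3 := by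
    intro T _
    have h : T.verts.ncard ≤ Fintype.card β + 2 := by
      refine (Set.ncard_le_ncard (Set.subset_univ _)).trans ?_
      rw [Set.ncard_univ, Nat.card_eq_fintype_card, Fintype.card_sum, Fintype.card_fin, add_comm]
    have h' : (T.verts.ncard : ℝ) ≤ Fintype.card β + 2 := by exact_mod_cast h
    have : (0 : ℝ) ≤ T.verts.ncard := Nat.cast_nonneg _
    have : (0 : ℝ) ≤ Fintype.card β := Nat.cast_nonneg _
    rw [abs_le, centralOrder]
    constructor <;> linarith
  refine (sum_le_card_nsmul _ _ _ hb).trans ?_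
  rw [nsmul_eq_mul, mul_comm, ← Set.ncard_eq_toFinset_card _ hfin]
  gcongr
  exact_mod_cast ncard_hubMissingSubtrees_le hG

lemma finsum_hubNonadjSubtrees (hub : ∀ i j, G.Adj (Sum.inl i) (Sum.inr j))
    (hG : ∀ j k, ¬ G.Adj (Sum.inr j) (Sum.inr k)) :
    ∑ᶠ T ∈ hubNonadjSubtrees G, ((T.verts.ncard : ℝ) - centralOrder β) = 0 := by
  classical
  rw [← finsum_mem_eq_of_bijOn _ (bijOn_hubNonadjSubtrees hub hG) fun _ _ => rfl,
    finsum_mem_coe_finset, sum_sigma]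
  refine sum_eq_zero fun v _ => ?_
  have hw : ∀ c ∈ vanishingOn {v},
      {j | (j = v ∨ c j = Fin.succ 0) ∨ (j = v ∨ c j = Fin.succ (1 : Fin 2))}.ncard =
        #{j | c j ≠ 0} + 1 := by
    intro c hc
    rw [mem_vanishingOn] at hc
    have : {j | (j = v ∨ c j = Fin.succ 0) ∨ (j = v ∨ c j = Fin.succ (1 : Fin 2))} =
        (insert v ({j | c j ≠ 0} : Finset β) : Finset β) := by
      ext j
      rw [mem_coe, mem_insert, mem_filter, and_iff_right (mem_univ _), ← succ_zero_or_one_iff]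
      simp only [Set.mem_ofPred_eq]
      tauto
    rw [this, Set.ncard_coe_finset, card_insert_of_notMem]
    simp [hc]
  have h := sum_card_ne_zero_vanishingOn {v}
  rw [card_compl, card_singleton] at h
  have hpos : 1 ≤ Fintype.card β := Fintype.card_pos_iff.2 ⟨v⟩
  zify [hpos] at h
  have h' : (3 : ℝ) * ∑ c ∈ vanishingOn {v}, (#{j | c j ≠ 0} : ℝ) =
    2 * (Fintype.card β - 1) * #(vanishingOn {v}) := by exact_mod_cast h
  rw [sum_congr rfl (g := fun c => ((#{j | c j ≠ 0} : ℝ) + (3 - centralOrder β)))]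
  · rw [sum_add_distrib, sum_const, nsmul_eq_mul, centralOrder]
    linarith
  · intro c hc
    rw [ncard_verts_hubSubgraph, hw c hc]
    push_cast
    ring

lemma ncard_hubNonadjSubtrees (hub : ∀ i j, G.Adj (Sum.inl i) (Sum.inr j))
    (hG : ∀ j k, ¬ G.Adj (Sum.inr j) (Sum.inr k)) :
    (hubNonadjSubtrees G).ncard = Fintype.card β * 3 ^ (Fintype.card β - 1) := by
  classical
  have h := bijOn_hubNonadjSubtrees hub hG
  rw [← h.image_eq, h.injOn.ncard_image, Set.ncard_coe_finset, card_sigma]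
  simp [card_vanishingOn, card_compl]

lemma abs_finsum_hubAdjSubtrees_le (hub : ∀ i j, G.Adj (Sum.inl i) (Sum.inr j))
    (hG : ∀ j k, ¬ G.Adj (Sum.inr j) (Sum.inr k)) :
    |∑ᶠ T ∈ hubAdjSubtrees G, ((T.verts.ncard : ℝ) - centralOrder β)| ≤
      3 ^ Fintype.card β / 3 := by
  classical
  by_cases h01 : G.Adj (Sum.inl 0) (Sum.inl 1)
  · rw [← finsum_mem_eq_of_bijOn _ (bijOn_hubAdjSubtrees hub hG h01) fun _ _ => rfl,
      finsum_mem_coe_finset]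
    have hw (c : β → Fin 3) :
        {j | c j = Fin.succ 0 ∨ c j = Fin.succ (1 : Fin 2)}.ncard = #{j | c j ≠ 0} := by
      rw [← Set.ncard_coe_finset]
      congr 1
      ext j
      rw [mem_coe, mem_filter, and_iff_right (mem_univ _), ← succ_zero_or_one_iff]
      rfl
    have h := sum_card_ne_zero_vanishingOn (∅ : Finset β)
    have hc := card_vanishingOn (∅ : Finset β)
    rw [compl_empty, card_univ] at h hc
    rw [hc] at h
    have h' : (3 : ℝ) * ∑ c ∈ vanishingOn (∅ : Finset β), (#{j | c j ≠ 0} : ℝ) =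
      2 * Fintype.card β * 3 ^ Fintype.card β := by exact_mod_cast h
    simp only [ncard_verts_hubSubgraph, hw]
    rw [sum_sub_distrib, sum_const, nsmul_eq_mul, hc, centralOrder]
    push_cast
    rw [sum_add_distrib, sum_const, nsmul_eq_mul, hc]
    push_cast
    rw [abs_le]
    have : (0 : ℝ) < 3 ^ Fintype.card β := by positivity
    constructor <;> linarith
  · have : hubAdjSubtrees G = ∅ :=
      Set.eq_empty_iff_forall_notMem.2 fun T hT => h01 hT.2.adj_sub
    rw [this, finsum_mem_empty, abs_zero]
    positivity

lemma abs_mu_sub_centralOrder_le [Nonempty β] (hub : ∀ i j, G.Adj (Sum.inl i) (Sum.inr j))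
    (hG : ∀ j k, ¬ G.Adj (Sum.inr j) (Sum.inr k)) :
    |mu G - centralOrder β| ≤ 48 * (2 / 3) ^ Fintype.card β + 1 / (Fintype.card β : ℝ) := by
  set m := Fintype.card β with hm
  have hm1 : 1 ≤ m := Fintype.card_pos
  have hm1' : (1 : ℝ) ≤ m := by exact_mod_cast hm1
  have hN : (m * 3 ^ m / 3 : ℝ) ≤ numSubtrees G := by
    have h : (hubNonadjSubtrees G).ncard ≤ numSubtrees G :=
      Set.ncard_le_ncard fun T hT => hT.1
    rw [ncard_hubNonadjSubtrees hub hG, ← hm] at h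
    have h' : (m * 3 ^ (m - 1) : ℝ) ≤ numSubtrees G := by exact_mod_cast h
    obtain ⟨k, hk⟩ := Nat.exists_eq_add_of_le' hm1
    rw [hk, Nat.add_sub_cancel] at h'
    rw [hk, pow_succ]
    linarith
  have hpos : (0 : ℝ) < m * 3 ^ m / 3 := by positivity
  have hNpos : (0 : ℝ) < numSubtrees G := hpos.trans_le hN
  have hdisj : Disjoint (hubNonadjSubtrees G) (hubAdjSubtrees G) :=
    Set.disjoint_left.2 fun T h h' => h.2.2 h'.2
  have hdisj' : Disjoint (hubMissingSubtrees G) (hubNonadjSubtrees G ∪ hubAdjSubtrees G) := by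
    refine Set.disjoint_left.2 fun T ⟨_, i, hi⟩ h => ?_
    rcases h with h | h
    · exact hi (h.2.1 i)
    · fin_cases i
      · exact hi h.2.fst_mem
      · exact hi h.2.snd_mem
  have hsum : |∑ᶠ T ∈ subtrees G, (T.verts.ncard : ℝ) - centralOrder β * numSubtrees G| ≤
      (m + 3) * 2 ^ (m + 2) + 3 ^ m / 3 := by
    rw [numSubtrees, ← finsum_mem_sub_const (Set.toFinite _), subtrees_eq_union,
      finsum_mem_union hdisj' (Set.toFinite _) (Set.toFinite _),
      finsum_mem_union hdisj (Set.toFinite _) (Set.toFinite _),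
      finsum_hubNonadjSubtrees hub hG, zero_add]
    exact (abs_add_le _ _).trans
      (add_le_add (abs_finsum_hubMissingSubtrees_le hG) (abs_finsum_hubAdjSubtrees_le hub hG))
  have hdiff : mu G - centralOrder β =
      (∑ᶠ T ∈ subtrees G, (T.verts.ncard : ℝ) - centralOrder β * numSubtrees G) /
        numSubtrees G := by
    rw [mu]
    field_simp
  rw [hdiff, abs_div, abs_of_pos hNpos]
  refine (div_le_div₀ (by positivity) hsum hpos hN).trans ?_
  have hbound : ((m : ℝ) + 3) * 2 ^ (m + 2) ≤ 16 * m * 2 ^ m := by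
    rw [pow_add]
    nlinarith [mul_nonneg (sub_nonneg.2 hm1') (pow_nonneg (zero_le_two (α := ℝ)) m)]
  rw [div_le_iff₀ hpos, div_pow]
  have : (48 * (2 ^ m / 3 ^ m) + 1 / (m : ℝ)) * (m * 3 ^ m / 3) =
      16 * m * 2 ^ m + 3 ^ m / 3 := by
    field_simp
    ring
  rw [this]
  linarith

end estimate

lemma abs_mu_completeBipartite_sub_mu_Hgraph_le {n : ℕ} (hn : 3 ≤ n) :
    |mu (completeBipartiteGraph (Fin 2) (Fin (n - 2))) - mu (Hgraph n)| ≤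
      2 * (48 * (2 / 3) ^ (n - 2) + 1 / ((n - 2 : ℕ) : ℝ)) := by
  have : Nonempty (Fin (n - 2)) := ⟨⟨0, by omega⟩⟩
  have h1 := abs_mu_sub_centralOrder_le (G := completeBipartiteGraph (Fin 2) (Fin (n - 2)))
    (by simp) (by simp)
  have h2 := abs_mu_sub_centralOrder_le (G := Hgraph n)
    (by simp [Hgraph, addEdge]) (by simp [Hgraph, addEdge])
  rw [Fintype.card_fin] at h1 h2
  rw [two_mul]
  exact (abs_sub_le _ (centralOrder (Fin (n - 2))) _).trans
    (add_le_add h1 (by rwa [abs_sub_comm]))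

end

/-- The difference `μ(K_{2,n-2}) - μ(H_n)` tends to `0` as `n → ∞`. -/
theorem mu_completeBipartite_sub_mu_Hgraph_tendsto_zero :
    Tendsto (fun n : ℕ =>
        mu (completeBipartiteGraph (Fin 2) (Fin (n - 2))) - mu (Hgraph n))
      atTop (𝓝 0) := by
  have hsub : Tendsto (fun n : ℕ => n - 2) atTop atTop := tendsto_sub_atTop_nat 2
  have hlim : Tendsto (fun n : ℕ => 2 * (48 * (2 / 3 : ℝ) ^ (n - 2) + 1 / ((n - 2 : ℕ) : ℝ)))
      atTop (𝓝 0) := by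
    have h1 := (tendsto_pow_atTop_nhds_zero_of_lt_one (r := (2 / 3 : ℝ)) (by norm_num)
      (by norm_num)).comp hsub
    have h2 := (tendsto_one_div_atTop_nhds_zero_nat (𝕜 := ℝ)).comp hsub
    simpa using ((h1.const_mul 48).add h2).const_mul 2
  refine squeeze_zero_norm' ?_ hlim
  filter_upwards [eventually_ge_atTop 3] with n hn
  exact abs_mu_completeBipartite_sub_mu_Hgraph_le hn

end SubtreePaper
end
end

section
/- Let n and s be nonnegative integers with 2s ≤ n − 3. Let T_{n,s} be the tree obtained from a path of order n − 2s with endvertices u and v by attaching s new leaves to u and s new leaves to v, and let G_{n,s} be the graph obtained from T_{n,s} by adding the edge e = uv. Then the local mean subtree order of G_{n,s} at e satisfies μ(G_{n,s}, e) = (2n − s + 2)/3. -/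
open Filter Topology

noncomputable section

namespace SubtreePaper

/-- The tree `T_{n,s}`: a path on the vertices `Sum.inl 0, …, Sum.inl (n - 2s - 1)`
(of order `n - 2s`), with the `s` leaves `Sum.inr (Sum.inl j)` attached to the
endvertex `Sum.inl 0`, and the `s` leaves `Sum.inr (Sum.inr j)` attached to the
endvertex `Sum.inl (n - 2s - 1)`. -/
def Tns (n s : ℕ) : SimpleGraph (Fin (n - 2 * s) ⊕ Fin s ⊕ Fin s) :=
  SimpleGraph.fromRel fun a b =>
    match a, b with
    | Sum.inl i, Sum.inl j => (i : ℕ) + 1 = (j : ℕ)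
    | Sum.inl i, Sum.inr (Sum.inl _) => (i : ℕ) = 0
    | Sum.inl i, Sum.inr (Sum.inr _) => (i : ℕ) = n - 2 * s - 1
    | _, _ => False

/-- The endvertex `u` of the path in `T_{n,s}`. -/
def pu (n s : ℕ) (h : 2 * s + 3 ≤ n) : Fin (n - 2 * s) ⊕ Fin s ⊕ Fin s :=
  Sum.inl ⟨0, by omega⟩

/-- The endvertex `v` of the path in `T_{n,s}`. -/
def pv (n s : ℕ) (h : 2 * s + 3 ≤ n) : Fin (n - 2 * s) ⊕ Fin s ⊕ Fin s :=
  Sum.inl ⟨n - 2 * s - 1, by omega⟩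

/-- The graph `G_{n,s}`, obtained from `T_{n,s}` by adding the edge `uv`. -/
def Gns (n s : ℕ) (h : 2 * s + 3 ≤ n) :
    SimpleGraph (Fin (n - 2 * s) ⊕ Fin s ⊕ Fin s) :=
  addEdge (Tns n s) (pu n s h) (pv n s h)

/-- A finite graph is a tree if it has a rank function such that every vertex other than `r` has
exactly one neighbour of smaller rank, adjacent vertices have distinct ranks, and `r` has rank `0`. -/
lemma isTree_of_rank {V : Type*} [Finite V] (G : SimpleGraph V) (r : V) (d : V → ℕ)
    (hex : ∀ v, v ≠ r → ∃ w, G.Adj v w ∧ d w < d v)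
    (hne : ∀ v w, G.Adj v w → d v ≠ d w)
    (hr : d r = 0)
    (huniq : ∀ v w w', G.Adj v w → G.Adj v w' → d w < d v → d w' < d v → w = w') :
    G.IsTree := by
  classical
  have hreach : ∀ k v, d v = k → G.Reachable v r := by
    intro k
    induction k using Nat.strong_induction_on with
    | _ k ih =>
      intro v hv
      by_cases hvr : v = r
      · rw [hvr]
      · obtain ⟨w, hw, hd⟩ := hex v hvr
        exact hw.reachable.trans (ih (d w) (hv ▸ hd) w rfl)
  have hconn : G.Connected :=
    { preconnected := fun v w => (hreach _ v rfl).trans (hreach _ w rfl).symm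
      nonempty := ⟨r⟩ }
  choose! p hp using hex
  have hsub : G.edgeSet ⊆ (fun v => s(v, p v)) '' {v | v ≠ r} := by
    intro e
    induction e using Sym2.ind with
    | _ x y =>
      intro hxy
      rw [SimpleGraph.mem_edgeSet] at hxy
      rcases lt_or_gt_of_ne (hne x y hxy) with hlt | hlt
      · have hy : y ≠ r := by
          rintro rfl
          omega
        refine ⟨y, hy, ?_⟩
        have : p y = x := huniq y _ _ (hp y hy).1 hxy.symm (hp y hy).2 hlt
        simp [this, Sym2.eq_swap]
      · have hx : x ≠ r := by
          rintro rfl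
          omega
        refine ⟨x, hx, ?_⟩
        have : p x = y := huniq x _ _ (hp x hx).1 hxy (hp x hx).2 hlt
        simp [this]
  have hle : G.edgeSet.ncard ≤ {v | v ≠ r}.ncard :=
    (Set.ncard_le_ncard hsub (Set.toFinite _)).trans (Set.ncard_image_le (Set.toFinite _))
  have hcompl : {v | v ≠ r}.ncard + 1 = Nat.card V := by
    have := Set.ncard_add_ncard_compl ({r} : Set V)
    rw [Set.ncard_singleton] at this
    rw [← this, add_comm]
    rfl
  have hge := hconn.card_vert_le_card_edgeSet_add_one
  rw [SimpleGraph.isTree_iff_connected_and_card]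
  refine ⟨hconn, ?_⟩
  rw [Nat.card_coe_set_eq] at hge ⊢
  omega

/-- A set containing a vertex of a connected subgraph and closed under adjacency contains all of
its vertices. -/
lemma verts_subset_of_closed {V : Type*} {G : SimpleGraph V} {H : G.Subgraph}
    (hH : H.coe.Connected) {C : Set V} {u : V} (hu : u ∈ H.verts) (huC : u ∈ C)
    (hC : ∀ x y, H.Adj x y → x ∈ C → y ∈ C) : H.verts ⊆ C := by
  intro v hv
  obtain ⟨w⟩ := hH.preconnected ⟨u, hu⟩ ⟨v, hv⟩
  have key : ∀ (x y : H.verts), H.coe.Walk x y → (x : V) ∈ C → (y : V) ∈ C := by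
    intro x y w
    induction w with
    | nil => exact id
    | cons hadj _ ih => exact fun hx => ih (hC _ _ hadj hx)
  exact key _ _ w huC

/-- The edges of `G_{n,s}`, each with one orientation. -/
def gnsRel (n s : ℕ) :
    (Fin (n - 2 * s) ⊕ Fin s ⊕ Fin s) → (Fin (n - 2 * s) ⊕ Fin s ⊕ Fin s) → Prop
  | Sum.inl i, Sum.inl j => (i : ℕ) + 1 = j ∨ ((i : ℕ) = 0 ∧ (j : ℕ) = n - 2 * s - 1)
  | Sum.inl i, Sum.inr (Sum.inl _) => (i : ℕ) = 0
  | Sum.inl i, Sum.inr (Sum.inr _) => (i : ℕ) = n - 2 * s - 1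
  | _, _ => False

lemma gns_adj {n s : ℕ} (h : 2 * s + 3 ≤ n) (x y : Fin (n - 2 * s) ⊕ Fin s ⊕ Fin s) :
    (Gns n s h).Adj x y ↔ gnsRel n s x y ∨ gnsRel n s y x := by
  rcases x with i | i | i <;> rcases y with j | j | j <;>
    simp [Gns, addEdge, Tns, pu, pv, gnsRel, Fin.ext_iff]
  omega

/-- The edges, each with one orientation, of the subtree of `G_{n,s}` containing `uv`, the path
edges outside the stretch from `a` to `b`, and the leaves in `A` and `B`. -/
def arcRel (n s a b : ℕ) (A B : Finset (Fin s)) :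
    (Fin (n - 2 * s) ⊕ Fin s ⊕ Fin s) → (Fin (n - 2 * s) ⊕ Fin s ⊕ Fin s) → Prop
  | Sum.inl i, Sum.inl j =>
    ((i : ℕ) + 1 = j ∧ ((i : ℕ) < a ∨ b ≤ (i : ℕ))) ∨ ((i : ℕ) = 0 ∧ (j : ℕ) = n - 2 * s - 1)
  | Sum.inl i, Sum.inr (Sum.inl x) => (i : ℕ) = 0 ∧ x ∈ A
  | Sum.inl i, Sum.inr (Sum.inr x) => (i : ℕ) = n - 2 * s - 1 ∧ x ∈ B
  | _, _ => False

/-- The vertices of the subtree described by `arcRel`. -/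
def arcVerts (n s a b : ℕ) (A B : Finset (Fin s)) : Set (Fin (n - 2 * s) ⊕ Fin s ⊕ Fin s)
  | Sum.inl i => (i : ℕ) ≤ a ∨ b ≤ (i : ℕ) ∨ (i : ℕ) = n - 2 * s - 1
  | Sum.inr (Sum.inl x) => x ∈ A
  | Sum.inr (Sum.inr x) => x ∈ B

section arcVerts

variable {n s a b : ℕ} {A B : Finset (Fin s)}

lemma inl_mem_arcVerts {i : Fin (n - 2 * s)} : Sum.inl i ∈ arcVerts n s a b A B ↔
    (i : ℕ) ≤ a ∨ b ≤ (i : ℕ) ∨ (i : ℕ) = n - 2 * s - 1 := Iff.rfl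

lemma inr_inl_mem_arcVerts {x : Fin s} :
    Sum.inr (Sum.inl x) ∈ arcVerts n s a b A B ↔ x ∈ A := Iff.rfl

lemma inr_inr_mem_arcVerts {x : Fin s} :
    Sum.inr (Sum.inr x) ∈ arcVerts n s a b A B ↔ x ∈ B := Iff.rfl

lemma arcRel_le_gnsRel {x y : Fin (n - 2 * s) ⊕ Fin s ⊕ Fin s} (hxy : arcRel n s a b A B x y) :
    gnsRel n s x y := by
  rcases x with i | i | i <;> rcases y with j | j | j <;> simp only [arcRel, gnsRel] at * <;> tauto

lemma arcRel_mem {x y : Fin (n - 2 * s) ⊕ Fin s ⊕ Fin s} (hxy : arcRel n s a b A B x y) :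
    x ∈ arcVerts n s a b A B ∧ y ∈ arcVerts n s a b A B := by
  rcases x with i | i | i <;> rcases y with j | j | j <;>
    simp only [arcRel, inl_mem_arcVerts, inr_inl_mem_arcVerts, inr_inr_mem_arcVerts] at * <;>
    first
      | omega
      | exact ⟨by omega, hxy.2⟩

lemma ncard_arcVerts (hab : a < b) (hb : b < n - 2 * s) :
    ((arcVerts n s a b A B).ncard : ℝ) = (a + 1 + (((n - 2 * s : ℕ) : ℝ) - b)) + (A.card + B.card) := by
  have hset : arcVerts n s a b A B =
      ((Finset.univ.filter fun i : Fin (n - 2 * s) => (i : ℕ) ≤ a ∨ b ≤ (i : ℕ)).disjSum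
        (A.disjSum B) : Finset _) := by
    ext x
    rcases x with i | i | i
    · simp [inl_mem_arcVerts]
      omega
    · simp [inr_inl_mem_arcVerts]
    · simp [inr_inr_mem_arcVerts]
  have hmap : (Finset.univ.filter fun i : Fin (n - 2 * s) => (i : ℕ) ≤ a ∨ b ≤ (i : ℕ)).map
      Fin.valEmbedding = (Finset.range (a + 1)).disjUnion (Finset.Ico b (n - 2 * s)) (by
        rw [Finset.disjoint_left]
        intro x
        simp
        omega) := by
    ext t
    simp only [Finset.mem_map, Finset.mem_filter, Finset.mem_univ, true_and, Fin.valEmbedding_apply,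
      Finset.mem_disjUnion, Finset.mem_range, Finset.mem_Ico]
    constructor
    · rintro ⟨i, hi, rfl⟩
      omega
    · intro ht
      exact ⟨⟨t, by omega⟩, by simp; omega, rfl⟩
  have hcard := congrArg Finset.card hmap
  rw [Finset.card_map, Finset.card_disjUnion, Finset.card_range, Nat.card_Ico] at hcard
  rw [hset, Set.ncard_coe_finset, Finset.card_disjSum, Finset.card_disjSum, hcard]
  push_cast [Nat.cast_sub hb.le]
  ring

end arcVerts

/-- The subtree of `G_{n,s}` containing `uv`, the path edges outside the stretch from `a` to `b`,
and the leaves in `A` and `B`. -/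
def arcSubgraph (n s : ℕ) (h : 2 * s + 3 ≤ n) (a b : ℕ) (A B : Finset (Fin s)) :
    (Gns n s h).Subgraph where
  verts := arcVerts n s a b A B
  Adj x y := arcRel n s a b A B x y ∨ arcRel n s a b A B y x
  adj_sub hxy := (gns_adj h _ _).2 (hxy.imp arcRel_le_gnsRel arcRel_le_gnsRel)
  edge_vert hxy := hxy.elim (fun k => (arcRel_mem k).1) (fun k => (arcRel_mem k).2)
  symm := ⟨fun _ _ => Or.symm⟩

/-- The distance to `u` in the subtree `arcSubgraph`. -/
def arcRank (n s a : ℕ) : (Fin (n - 2 * s) ⊕ Fin s ⊕ Fin s) → ℕ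
  | Sum.inl i => if (i : ℕ) ≤ a then i else n - 2 * s - i
  | Sum.inr (Sum.inl _) => 1
  | Sum.inr (Sum.inr _) => 2

section arcSubgraph

variable {n s a b : ℕ} (h : 2 * s + 3 ≤ n) {A B : Finset (Fin s)}

lemma arcSubgraph_isTree (hab : a < b) (hb : b < n - 2 * s) :
    (arcSubgraph n s h a b A B).coe.IsTree := by
  refine isTree_of_rank _ ⟨pu n s h, inl_mem_arcVerts.2 (Or.inl (Nat.zero_le _))⟩
    (fun v => arcRank n s a v) ?_ ?_ ?_ ?_
  · rintro ⟨v, hv⟩ hvr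
    replace hvr : v ≠ pu n s h := fun k => hvr (Subtype.ext k)
    suffices ∃ w, (arcSubgraph n s h a b A B).Adj v w ∧ arcRank n s a w < arcRank n s a v by
      obtain ⟨w, hw, hd⟩ := this
      exact ⟨⟨w, hw.snd_mem⟩, hw, hd⟩
    rcases v with i | x | x
    · have hi := i.2
      have hv' : (i : ℕ) ≤ a ∨ b ≤ (i : ℕ) ∨ (i : ℕ) = n - 2 * s - 1 := hv
      have hi0 : (i : ℕ) ≠ 0 := fun k => hvr (by simp [pu, Fin.ext_iff, k])
      by_cases hia : (i : ℕ) ≤ a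
      · refine ⟨Sum.inl ⟨i - 1, by omega⟩, ?_, ?_⟩
        · simp only [arcSubgraph, arcRel]
          omega
        · simp only [arcRank]
          split_ifs <;> omega
      · by_cases him : (i : ℕ) = n - 2 * s - 1
        · refine ⟨Sum.inl ⟨0, by omega⟩, ?_, ?_⟩
          · simp only [arcSubgraph, arcRel, true_and]
            omega
          · simp only [arcRank]
            split_ifs <;> omega
        · refine ⟨Sum.inl ⟨i + 1, by omega⟩, ?_, ?_⟩
          · simp only [arcSubgraph, arcRel, true_and]
            omega
          · simp only [arcRank]
            split_ifs <;> omega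
    · exact ⟨Sum.inl ⟨0, by omega⟩, Or.inr ⟨rfl, hv⟩, by simp [arcRank]⟩
    · refine ⟨Sum.inl ⟨n - 2 * s - 1, by omega⟩, Or.inr ⟨rfl, hv⟩, ?_⟩
      simp only [arcRank]
      split_ifs <;> omega
  · rintro ⟨v, hv⟩ ⟨w, hw⟩ hvw
    have hvw' : arcRel n s a b A B v w ∨ arcRel n s a b A B w v := hvw
    clear hvw
    change arcRank n s a v ≠ arcRank n s a w
    rcases hvw' with hvw | hvw <;> rcases v with i | i | i <;> rcases w with j | j | j <;>
      simp only [arcRel, arcRank] at hvw ⊢ <;> (try replace hvw := hvw.1) <;>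
      (try split_ifs) <;> omega
  · simp [arcRank, pu]
  · rintro ⟨v, hv⟩ ⟨w, hw⟩ ⟨w', hw'⟩ hvw hvw' hd hd'
    have h1 : arcRel n s a b A B v w ∨ arcRel n s a b A B w v := hvw
    have h2 : arcRel n s a b A B v w' ∨ arcRel n s a b A B w' v := hvw'
    replace hd : arcRank n s a w < arcRank n s a v := hd
    replace hd' : arcRank n s a w' < arcRank n s a v := hd'
    refine Subtype.ext (?_ : w = w')
    clear hvw hvw' hv hw hw'
    rcases h1 with h1 | h1 <;> rcases h2 with h2 | h2 <;>
      rcases v with i | i | i <;> rcases w with j | j | j <;> rcases w' with k | k | k <;>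
      simp only [arcRel, arcRank, Sum.inl.injEq, Fin.ext_iff] at h1 h2 hd hd' ⊢ <;>
      (try replace h1 := h1.1) <;> (try replace h2 := h2.1) <;>
      (try split_ifs at hd hd') <;> omega

lemma arcSubgraph_mem (hab : a < b) (hb : b < n - 2 * s) :
    arcSubgraph n s h a b A B ∈
      {H ∈ subtrees (Gns n s h) | s(pu n s h, pv n s h) ∈ H.edgeSet} :=
  ⟨arcSubgraph_isTree h hab hb, Or.inl (Or.inr ⟨rfl, rfl⟩)⟩

lemma arcSubgraph_adj_succ_iff {t : ℕ} (ht : t + 1 < n - 2 * s) :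
    (arcSubgraph n s h a b A B).Adj (Sum.inl ⟨t, by omega⟩) (Sum.inl ⟨t + 1, ht⟩) ↔
      t < a ∨ b ≤ t := by
  simp only [arcSubgraph, arcRel, true_and]
  omega

lemma arcSubgraph_inj {a' b' : ℕ} {A' B' : Finset (Fin s)} (hab : a < b) (hb : b < n - 2 * s)
    (hab' : a' < b') (hb' : b' < n - 2 * s)
    (heq : arcSubgraph n s h a b A B = arcSubgraph n s h a' b' A' B') :
    a = a' ∧ b = b' ∧ A = A' ∧ B = B' := by
  have hE : ∀ t, t + 1 < n - 2 * s → ((t < a ∨ b ≤ t) ↔ (t < a' ∨ b' ≤ t)) := by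
    intro t ht
    rw [← arcSubgraph_adj_succ_iff h (A := A) (B := B) ht,
      ← arcSubgraph_adj_succ_iff h (A := A') (B := B') ht, heq]
  have hV : arcVerts n s a b A B = arcVerts n s a' b' A' B' := congrArg (·.verts) heq
  refine ⟨?_, ?_, ?_, ?_⟩
  · have h1 := hE a (by omega)
    have h2 := hE a' (by omega)
    omega
  · have h1 := hE (b - 1) (by omega)
    have h2 := hE (b' - 1) (by omega)
    omega
  · ext x
    rw [← inr_inl_mem_arcVerts (n := n) (a := a) (b := b) (B := B), hV, inr_inl_mem_arcVerts]
  · ext x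
    rw [← inr_inr_mem_arcVerts (n := n) (a := a) (b := b) (A := A), hV, inr_inr_mem_arcVerts]

/-- A subtree of `G_{n,s}` containing `uv` misses some edge of the path. -/
lemma exists_not_adj_succ {H : (Gns n s h).Subgraph} (hH : H.coe.IsTree)
    (huv : H.Adj (pu n s h) (pv n s h)) :
    ∃ t, ∃ ht : t + 1 < n - 2 * s, ¬ H.Adj (Sum.inl ⟨t, by omega⟩) (Sum.inl ⟨t + 1, ht⟩) := by
  by_contra! hall
  have hbr := SimpleGraph.isAcyclic_iff_forall_adj_isBridge.1 hH.isAcyclic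
    (v := ⟨pu n s h, huv.fst_mem⟩) (w := ⟨pv n s h, huv.snd_mem⟩) huv
  rw [SimpleGraph.isBridge_iff] at hbr
  apply hbr
  have hmem : ∀ t (ht : t < n - 2 * s),
      (Sum.inl ⟨t, ht⟩ : Fin (n - 2 * s) ⊕ Fin s ⊕ Fin s) ∈ H.verts
    | 0, _ => huv.fst_mem
    | t + 1, ht => (hall t ht).snd_mem
  have hreach : ∀ t (ht : t < n - 2 * s),
      (H.coe.deleteEdges {s(⟨pu n s h, huv.fst_mem⟩, ⟨pv n s h, huv.snd_mem⟩)}).Reachable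
        ⟨pu n s h, huv.fst_mem⟩ ⟨Sum.inl ⟨t, ht⟩, hmem t ht⟩ := by
    intro t
    induction t with
    | zero => exact fun _ => SimpleGraph.Reachable.refl _
    | succ t ih =>
      intro ht
      refine (ih (by omega)).trans (SimpleGraph.Adj.reachable ?_)
      rw [SimpleGraph.deleteEdges_adj]
      refine ⟨hall t ht, ?_⟩
      simp [pu, pv]
      omega
  exact hreach (n - 2 * s - 1) (by omega)

lemma exists_eq_arcSubgraph {H : (Gns n s h).Subgraph} (hH : H.coe.IsTree)
    (huv : H.Adj (pu n s h) (pv n s h)) :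
    ∃ a b A B, a < b ∧ b < n - 2 * s ∧ arcSubgraph n s h a b A B = H := by
  classical
  let E : ℕ → Prop := fun t =>
    ∃ ht : t + 1 < n - 2 * s, ¬ H.Adj (Sum.inl ⟨t, by omega⟩) (Sum.inl ⟨t + 1, ht⟩)
  have hE : ∃ t, E t := exists_not_adj_succ h hH huv
  obtain ⟨a, haE, ha⟩ : ∃ a, E a ∧ ∀ t, t < a → ¬ E t :=
    ⟨Nat.find hE, Nat.find_spec hE, fun t => Nat.find_min hE⟩
  obtain ⟨c, hcE, hc⟩ : ∃ c, E c ∧ ∀ t, c < t → ¬ E t := by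
    refine ⟨Nat.findGreatest E (n - 2 * s), Nat.findGreatest_spec (by have := haE.1; omega) haE, ?_⟩
    intro t hct hEt
    exact Nat.findGreatest_is_greatest hct (by have := hEt.1; omega) hEt
  have hac : a ≤ c := not_lt.1 fun k => ha c k hcE
  obtain ⟨haL, haE⟩ := haE
  obtain ⟨hcL, hcE⟩ := hcE
  have hout : ∀ t (ht : t + 1 < n - 2 * s), t < a ∨ c + 1 ≤ t →
      H.Adj (Sum.inl ⟨t, by omega⟩) (Sum.inl ⟨t + 1, ht⟩) := by
    intro t ht htac
    by_contra hcon
    exact htac.elim (fun k => ha t k ⟨ht, hcon⟩) (fun k => hc t k ⟨ht, hcon⟩)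
  have hgap : H.verts ⊆ {x | ∀ i, x = Sum.inl i → (i : ℕ) ≤ a ∨ c + 1 ≤ (i : ℕ)} := by
    refine verts_subset_of_closed hH.connected huv.fst_mem ?_ ?_
    · intro i hi
      rw [pu, Sum.inl.injEq] at hi
      simp [← hi]
    · rintro x _ hxy hx j rfl
      by_contra! hj
      have hG := (gns_adj h _ _).1 (H.adj_sub hxy)
      rcases x with i | i | i
      · have hi := hx i rfl
        simp only [gnsRel] at hG
        have hij : ((i : ℕ) = a ∧ (j : ℕ) = a + 1) ∨ ((i : ℕ) = c + 1 ∧ (j : ℕ) = c) := by omega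
        rcases hij with ⟨h1, h2⟩ | ⟨h1, h2⟩
        · apply haE
          convert hxy using 2 <;> simp [Fin.ext_iff, h1, h2]
        · apply hcE
          convert hxy.symm using 2 <;> simp [Fin.ext_iff, h1, h2]
      · simp only [gnsRel, false_or] at hG
        omega
      · simp only [gnsRel, false_or] at hG
        omega
  have hpath : ∀ t (ht : t < n - 2 * s), t ≤ a ∨ c + 1 ≤ t →
      (Sum.inl ⟨t, ht⟩ : Fin (n - 2 * s) ⊕ Fin s ⊕ Fin s) ∈ H.verts := by
    intro t ht htac
    by_cases h0 : t = 0
    · subst h0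
      exact huv.fst_mem
    by_cases h1 : t = n - 2 * s - 1
    · subst h1
      exact huv.snd_mem
    rcases htac with hta | hct
    · obtain ⟨k, rfl⟩ := Nat.exists_eq_succ_of_ne_zero h0
      exact (hout k ht (Or.inl hta)).snd_mem
    · exact (hout t (by omega) (Or.inr hct)).fst_mem
  have hleaf : ∀ z w : Fin (n - 2 * s) ⊕ Fin s ⊕ Fin s, z ∈ H.verts → z ≠ pu n s h →
      (∀ x, (Gns n s h).Adj x z → x = w) → H.Adj w z := by
    intro z w hz hzu hw
    by_contra hcon
    refine verts_subset_of_closed (C := {x | x ≠ z}) hH.connected huv.fst_mem hzu.symm ?_ hz rfl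
    rintro x y hxy - rfl
    exact hcon (hw x (H.adj_sub hxy) ▸ hxy)
  let A : Finset (Fin s) := Finset.univ.filter fun x => Sum.inr (Sum.inl x) ∈ H.verts
  let B : Finset (Fin s) := Finset.univ.filter fun x => Sum.inr (Sum.inr x) ∈ H.verts
  have hA : ∀ x, x ∈ A ↔ Sum.inr (Sum.inl x) ∈ H.verts := by simp [A]
  have hB : ∀ x, x ∈ B ↔ Sum.inr (Sum.inr x) ∈ H.verts := by simp [B]
  have hrel : ∀ x y, gnsRel n s x y → (arcRel n s a (c + 1) A B x y ↔ H.Adj x y) := by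
    intro x y hxy
    rcases x with i | i | i <;> rcases y with j | j | j <;> simp only [gnsRel] at hxy
    · simp only [arcRel]
      rcases hxy with hij | ⟨hi, hj⟩
      · obtain ⟨i, hi⟩ := i
        obtain ⟨j, hj⟩ := j
        simp only at hij
        subst hij
        constructor
        · rintro (hk | hk)
          · exact hout i hj hk.2
          · simp only at hk
            omega
        · intro hadj
          refine Or.inl ⟨rfl, ?_⟩
          by_contra! hk
          simp only at hk
          have h1 := hgap hadj.fst_mem _ rfl
          have hia : i = a := by
            simp only at h1
            omega
          subst hia
          exact haE hadj
      · refine iff_of_true (Or.inr ⟨hi, hj⟩) ?_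
        have hu : Sum.inl i = pu n s h := congrArg Sum.inl (Fin.ext hi)
        have hv : Sum.inl j = pv n s h := congrArg Sum.inl (Fin.ext hj)
        rwa [hu, hv]
    · simp only [arcRel, hA, hxy, true_and]
      refine ⟨fun hz => hleaf _ _ hz (by simp [pu]) ?_, fun hadj => hadj.snd_mem⟩
      intro x hx
      rw [gns_adj] at hx
      rcases x with k | k | k <;> simp only [gnsRel, or_false, or_self] at hx
      rw [Sum.inl.injEq, Fin.ext_iff, hx, hxy]
    · simp only [arcRel, hB, hxy, true_and]
      refine ⟨fun hz => hleaf _ _ hz (by simp [pu]) ?_, fun hadj => hadj.snd_mem⟩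
      intro x hx
      rw [gns_adj] at hx
      rcases x with k | k | k <;> simp only [gnsRel, or_false, or_self] at hx
      rw [Sum.inl.injEq, Fin.ext_iff, hx, hxy]
  refine ⟨a, c + 1, A, B, by omega, by omega, SimpleGraph.Subgraph.ext ?_ ?_⟩
  · ext x
    rcases x with i | i | i
    · refine ⟨fun hx => ?_, fun hx => ?_⟩
      · have hx' : (i : ℕ) ≤ a ∨ c + 1 ≤ (i : ℕ) ∨ (i : ℕ) = n - 2 * s - 1 := hx
        exact hpath i i.2 (by omega)
      · exact inl_mem_arcVerts.2 ((hgap hx i rfl).imp_right Or.inl)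
    · exact hA i
    · exact hB i
  · ext x y
    refine ⟨?_, fun hxy => ?_⟩
    · rintro (hxy | hxy)
      · exact (hrel _ _ (arcRel_le_gnsRel hxy)).1 hxy
      · exact ((hrel _ _ (arcRel_le_gnsRel hxy)).1 hxy).symm
    · rcases (gns_adj h x y).1 (H.adj_sub hxy) with hG | hG
      · exact Or.inl ((hrel _ _ hG).2 hxy)
      · exact Or.inr ((hrel _ _ hG).2 hxy.symm)

end arcSubgraph

lemma sum_card_finset_fin (s : ℕ) :
    ∑ A : Finset (Fin s), (A.card : ℝ) = s * 2 ^ s / 2 := by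
  have hcompl : ∑ A : Finset (Fin s), (A.card : ℝ) = ∑ A : Finset (Fin s), ((s : ℝ) - A.card) := by
    rw [← Equiv.sum_comp ((compl_involutive (α := Finset (Fin s))).toPerm compl)]
    refine Finset.sum_congr rfl fun A _ => ?_
    rw [Function.Involutive.coe_toPerm, Finset.card_compl, Fintype.card_fin,
      Nat.cast_sub (by simpa using A.card_le_univ)]
  rw [Finset.sum_sub_distrib] at hcompl
  simp only [Finset.sum_const, Finset.card_univ, Fintype.card_finset, Fintype.card_fin,
    nsmul_eq_mul, Nat.cast_pow, Nat.cast_ofNat] at hcompl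
  linarith

lemma sum_add_card_finset_fin (s : ℕ) (x : ℝ) :
    ∑ q : Finset (Fin s) × Finset (Fin s), (x + ((q.1.card : ℝ) + q.2.card)) =
      2 ^ s * 2 ^ s * (x + s) := by
  simp only [Fintype.sum_prod_type, Finset.sum_add_distrib, Finset.sum_const, Finset.card_univ,
    Fintype.card_prod, Fintype.card_finset, Fintype.card_fin, nsmul_eq_mul, ← Finset.mul_sum,
    sum_card_finset_fin]
  push_cast
  ring

lemma sum_range_const (b : ℕ) (x : ℝ) :
    ∑ a ∈ Finset.range b, ((a : ℝ) + 1 + x) = b * (b + 1) / 2 + b * x := by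
  induction b with
  | zero => simp
  | succ b ih =>
    rw [Finset.sum_range_succ, ih]
    push_cast
    ring

lemma sum_range_arc (m : ℕ) (x : ℝ) :
    ∑ b ∈ Finset.range m, ∑ a ∈ Finset.range b, ((a : ℝ) + 1 + (x - b)) =
      m * (m - 1) / 2 * x - m * (m - 1) * (m - 2) / 6 := by
  simp only [sum_range_const]
  induction m with
  | zero => simp
  | succ m ih =>
    rw [Finset.sum_range_succ, ih]
    push_cast
    ring

lemma sum_range_cast (m : ℕ) : ∑ b ∈ Finset.range m, (b : ℝ) = m * (m - 1) / 2 := by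
  induction m with
  | zero => simp
  | succ m ih =>
    rw [Finset.sum_range_succ, ih]
    push_cast
    ring

/-- The parameters `((b, a), (A, B))` of the subtrees of `G_{n,s}` containing `uv`. -/
def arcParams (n s : ℕ) : Finset ((Σ _ : ℕ, ℕ) × Finset (Fin s) × Finset (Fin s)) :=
  ((Finset.range (n - 2 * s)).sigma fun b => Finset.range b) ×ˢ Finset.univ

lemma mem_arcParams {n s : ℕ} {p : (Σ _ : ℕ, ℕ) × Finset (Fin s) × Finset (Fin s)} :
    p ∈ arcParams n s ↔ p.1.2 < p.1.1 ∧ p.1.1 < n - 2 * s := by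
  simp [arcParams, and_comm]

/-- For `2s ≤ n - 3`, the local mean subtree order of `G_{n,s}` at the added edge
`e = uv` is `(2n - s + 2)/3`. -/
theorem muEdge_Gns (n s : ℕ) (h : 2 * s + 3 ≤ n) :
    muEdge (Gns n s h) s(pu n s h, pv n s h) = (2 * (n : ℝ) - s + 2) / 3 := by
  let f : (Σ _ : ℕ, ℕ) × Finset (Fin s) × Finset (Fin s) → (Gns n s h).Subgraph :=
    fun p => arcSubgraph n s h p.1.2 p.1.1 p.2.1 p.2.2
  have himage : {H ∈ subtrees (Gns n s h) | s(pu n s h, pv n s h) ∈ H.edgeSet} =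
      f '' (arcParams n s : Set _) := by
    ext H
    constructor
    · rintro ⟨hH, huv⟩
      obtain ⟨a, b, A, B, hab, hb, rfl⟩ := exists_eq_arcSubgraph h hH huv
      exact ⟨(⟨b, a⟩, A, B), mem_arcParams.2 ⟨hab, hb⟩, rfl⟩
    · rintro ⟨p, hp, rfl⟩
      obtain ⟨hab, hb⟩ := mem_arcParams.1 hp
      exact arcSubgraph_mem h hab hb
  have hinj : Set.InjOn f (arcParams n s : Set _) := by
    rintro ⟨⟨b, a⟩, A, B⟩ hp ⟨⟨b', a'⟩, A', B'⟩ hp' heq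
    obtain ⟨hab, hb⟩ := mem_arcParams.1 hp
    obtain ⟨hab', hb'⟩ := mem_arcParams.1 hp'
    obtain ⟨rfl, rfl, rfl, rfl⟩ := arcSubgraph_inj h hab hb hab' hb' heq
    rfl
  have hm : ((n - 2 * s : ℕ) : ℝ) = n - 2 * s := by
    rw [Nat.cast_sub (by omega)]
    push_cast
    ring
  have hm3 : (3 : ℝ) ≤ n - 2 * s := by
    rw [← hm]
    exact_mod_cast (by omega : 3 ≤ n - 2 * s)
  have hcard : ((arcParams n s).card : ℝ) =
      (n - 2 * s) * (n - 2 * s - 1) / 2 * (2 ^ s * 2 ^ s) := by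
    rw [arcParams, Finset.card_product, Finset.card_sigma]
    simp only [Finset.card_range, Finset.card_univ, Fintype.card_prod, Fintype.card_finset,
      Fintype.card_fin]
    push_cast
    rw [sum_range_cast, hm]
  have hsum : ∑ p ∈ arcParams n s, ((f p).verts.ncard : ℝ) =
      (n - 2 * s) * (n - 2 * s - 1) / 2 * (2 ^ s * 2 ^ s) * ((2 * (n : ℝ) - s + 2) / 3) := by
    have hterm : ∀ p ∈ arcParams n s, ((f p).verts.ncard : ℝ) =
        ((p.1.2 : ℝ) + 1 + (((n - 2 * s : ℕ) : ℝ) - p.1.1)) + (p.2.1.card + p.2.2.card) :=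
      fun p hp => ncard_arcVerts (mem_arcParams.1 hp).1 (mem_arcParams.1 hp).2
    have hreal : ∀ x : Σ _ : ℕ, ℕ, (2 : ℝ) ^ s * 2 ^ s *
        ((x.2 : ℝ) + 1 + (((n - 2 * s : ℕ) : ℝ) - x.1) + s) =
        2 ^ s * 2 ^ s * ((x.2 : ℝ) + 1 + (((n - 2 * s : ℕ) : ℝ) + s - x.1)) := fun x => by ring
    rw [Finset.sum_congr rfl hterm, arcParams, Finset.sum_product]
    simp only [sum_add_card_finset_fin, hreal]
    rw [← Finset.mul_sum, Finset.sum_sigma, sum_range_arc, hm]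
    ring
  rw [muEdge, himage, finsum_mem_image hinj, finsum_mem_coe_finset,
    hinj.ncard_image, Set.ncard_coe_finset, hsum, hcard, mul_div_cancel_left₀]
  have : (n - 2 * s - 1 : ℝ) ≠ 0 := by linarith
  have : (n - 2 * s : ℝ) ≠ 0 := by linarith
  positivity

end SubtreePaper
end
end

section
/- Let n and s be nonnegative integers with 2s ≤ n − 3. Let T_{n,s} be the tree obtained from a path of order n − 2s with endvertices u and v by attaching s new leaves to u and s new leaves to v, and let G_{n,s} be the graph obtained from T_{n,s} by adding the edge e = uv. Then the number of subtrees of G_{n,s} that contain the edge e equals C(n−2s, 2) · 2^{2s}, where C(m,2) = m(m−1)/2. -/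
open Filter Topology

noncomputable section

namespace SubtreePaper

/-- A graph is acyclic as soon as its vertices can be ranked so that adjacent vertices have distinct
ranks and each vertex has at most one neighbour of smaller rank. -/
theorem isAcyclic_of_rank {V : Type*} {G : SimpleGraph V} (f : V → ℕ)
    (hne : ∀ x y, G.Adj x y → f x ≠ f y)
    (huniq : ∀ x y z, G.Adj x y → G.Adj x z → f y < f x → f z < f x → y = z) :
    G.IsAcyclic := by
  classical
  intro v c hc
  obtain ⟨w, hw, hmax⟩ := c.support.toFinset.exists_max_image f ⟨v, by simp⟩
  rw [List.mem_toFinset] at hw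
  have hc' := hc.rotate hw
  have hlt : ∀ x, G.Adj w x → x ∈ (c.rotate w hw).support → f x < f w := by
    intro x hx hxs
    refine lt_of_le_of_ne (hmax x ?_) (hne _ _ hx).symm
    simpa [SimpleGraph.Walk.mem_support_rotate_iff] using hxs
  have h1 := (c.rotate w hw).adj_snd hc'.not_nil
  have h2 := ((c.rotate w hw).adj_penultimate hc'.not_nil).symm
  exact hc'.snd_ne_penultimate (huniq w _ _ h1 h2
    (hlt _ h1 ((c.rotate w hw).getVert_mem_support _))
    (hlt _ h2 ((c.rotate w hw).getVert_mem_support _)))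

/-- The position on the path of the endvertex to which a leaf of `T_{n,s}` is attached. -/
def leafBase (n s : ℕ) : Fin s ⊕ Fin s → ℕ
  | Sum.inl _ => 0
  | Sum.inr _ => n - 2 * s - 1

theorem leafBase_eq (n s : ℕ) (x : Fin s ⊕ Fin s) :
    leafBase n s x = 0 ∨ leafBase n s x = n - 2 * s - 1 := by
  cases x <;> simp [leafBase]

section

variable {n s : ℕ} {h : 2 * s + 3 ≤ n}

theorem Gns_adj_inl_inl (a b : Fin (n - 2 * s)) :
    (Gns n s h).Adj (Sum.inl a) (Sum.inl b) ↔
      (a : ℕ) + 1 = b ∨ (b : ℕ) + 1 = a ∨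
        ((a : ℕ) = 0 ∧ (b : ℕ) = n - 2 * s - 1) ∨ ((b : ℕ) = 0 ∧ (a : ℕ) = n - 2 * s - 1) := by
  simp only [Gns, addEdge, Tns, pu, pv, SimpleGraph.sup_adj, SimpleGraph.fromRel_adj,
    SimpleGraph.fromEdgeSet_adj, Set.mem_singleton_iff, Sym2.eq_iff, Sum.inl.injEq, ne_eq,
    Fin.ext_iff]
  omega

theorem Gns_adj_inl_inr (a : Fin (n - 2 * s)) (x : Fin s ⊕ Fin s) :
    (Gns n s h).Adj (Sum.inl a) (Sum.inr x) ↔ (a : ℕ) = leafBase n s x := by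
  cases x <;> simp [Gns, addEdge, Tns, pu, pv, leafBase]

theorem Gns_adj_inr_inl (a : Fin (n - 2 * s)) (x : Fin s ⊕ Fin s) :
    (Gns n s h).Adj (Sum.inr x) (Sum.inl a) ↔ (a : ℕ) = leafBase n s x := by
  rw [SimpleGraph.adj_comm, Gns_adj_inl_inr]

theorem not_Gns_adj_inr_inr (x y : Fin s ⊕ Fin s) :
    ¬ (Gns n s h).Adj (Sum.inr x) (Sum.inr y) := by
  cases x <;> cases y <;> simp [Gns, addEdge, Tns, pu, pv]

variable (h) in
/-- The subtree of `G_{n,s}` consisting of the added edge, the initial segment `0, …, i` and the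
final segment `j, …, n - 2s - 1` of the path, and the leaves in `L`. -/
def segmentTree (i j : Fin (n - 2 * s)) (L : Finset (Fin s ⊕ Fin s)) :
    (Gns n s h).Subgraph where
  verts := {x | match x with
    | Sum.inl a => a ≤ i ∨ j ≤ a
    | Sum.inr x => x ∈ L}
  Adj x y := match x, y with
    | Sum.inl a, Sum.inl b =>
      ((a : ℕ) + 1 = b ∧ (b ≤ i ∨ j ≤ a)) ∨ ((b : ℕ) + 1 = a ∧ (a ≤ i ∨ j ≤ b)) ∨
        ((a : ℕ) = 0 ∧ (b : ℕ) = n - 2 * s - 1) ∨ ((b : ℕ) = 0 ∧ (a : ℕ) = n - 2 * s - 1)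
    | Sum.inl a, Sum.inr x => (a : ℕ) = leafBase n s x ∧ x ∈ L
    | Sum.inr x, Sum.inl a => (a : ℕ) = leafBase n s x ∧ x ∈ L
    | Sum.inr _, Sum.inr _ => False
  adj_sub {x y} := by
    rcases x with a | x <;> rcases y with b | y <;>
      simp only [Gns_adj_inl_inl, Gns_adj_inl_inr, Gns_adj_inr_inl] <;> tauto
  edge_vert {x y} := by
    rcases x with a | x <;> rcases y with b | y
    · simp only [Set.mem_ofPred_eq, Fin.le_def]
      omega
    · rintro ⟨ha, -⟩
      have := leafBase_eq n s y
      simp only [Set.mem_ofPred_eq, Fin.le_def]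
      omega
    · exact fun hx => hx.2
    · exact False.elim
  symm := ⟨by
    rintro (a | x) (b | y) hxy
    · simp only at hxy ⊢
      tauto
    · exact hxy
    · exact hxy
    · exact hxy⟩

section segmentTree

variable {i j : Fin (n - 2 * s)} {L : Finset (Fin s ⊕ Fin s)}

theorem inl_mem_segmentTree_verts {a : Fin (n - 2 * s)} :
    Sum.inl a ∈ (segmentTree h i j L).verts ↔ a ≤ i ∨ j ≤ a := Iff.rfl

theorem inr_mem_segmentTree_verts {x : Fin s ⊕ Fin s} :
    Sum.inr x ∈ (segmentTree h i j L).verts ↔ x ∈ L := Iff.rfl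

theorem segmentTree_adj_inl_inl {a b : Fin (n - 2 * s)} :
    (segmentTree h i j L).Adj (Sum.inl a) (Sum.inl b) ↔
      ((a : ℕ) + 1 = b ∧ (b ≤ i ∨ j ≤ a)) ∨ ((b : ℕ) + 1 = a ∧ (a ≤ i ∨ j ≤ b)) ∨
        ((a : ℕ) = 0 ∧ (b : ℕ) = n - 2 * s - 1) ∨ ((b : ℕ) = 0 ∧ (a : ℕ) = n - 2 * s - 1) :=
  Iff.rfl

theorem segmentTree_adj_inl_inr {a : Fin (n - 2 * s)} {x : Fin s ⊕ Fin s} :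
    (segmentTree h i j L).Adj (Sum.inl a) (Sum.inr x) ↔ (a : ℕ) = leafBase n s x ∧ x ∈ L :=
  Iff.rfl

theorem segmentTree_adj_inr_inl {a : Fin (n - 2 * s)} {x : Fin s ⊕ Fin s} :
    (segmentTree h i j L).Adj (Sum.inr x) (Sum.inl a) ↔ (a : ℕ) = leafBase n s x ∧ x ∈ L :=
  Iff.rfl

theorem not_segmentTree_adj_inr_inr {x y : Fin s ⊕ Fin s} :
    ¬ (segmentTree h i j L).Adj (Sum.inr x) (Sum.inr y) := id

theorem pu_mem_segmentTree_verts : pu n s h ∈ (segmentTree h i j L).verts :=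
  inl_mem_segmentTree_verts.2 (Or.inl (Nat.zero_le _))

theorem segmentTree_adj_pu_pv : (segmentTree h i j L).Adj (pu n s h) (pv n s h) :=
  segmentTree_adj_inl_inl.2 (by simp)

theorem segmentTree_isAcyclic (hij : i < j) : (segmentTree h i j L).coe.IsAcyclic := by
  refine isAcyclic_of_rank (fun x => match x.1 with
    | Sum.inl a => if a ≤ i then (a : ℕ) else n - 2 * s - a
    | Sum.inr _ => n) ?_ ?_
  · rintro ⟨a | x, hx⟩ ⟨b | y, hy⟩ hxy <;> rw [SimpleGraph.Subgraph.coe_adj] at hxy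
    · rw [segmentTree_adj_inl_inl] at hxy
      simp only [Fin.le_def, Fin.lt_def] at *
      split_ifs <;> omega
    · simp only
      split_ifs <;> omega
    · simp only
      split_ifs <;> omega
    · exact absurd hxy not_segmentTree_adj_inr_inr
  · rintro ⟨a | x, hx⟩ ⟨b | y, hy⟩ ⟨c | z, hz⟩ hxy hxz hlt hlt' <;>
      rw [SimpleGraph.Subgraph.coe_adj] at hxy hxz
    · rw [segmentTree_adj_inl_inl] at hxy hxz
      simp only [Subtype.mk.injEq, Sum.inl.injEq, Fin.ext_iff, Fin.le_def, Fin.lt_def] at *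
      split_ifs at hlt hlt' <;> omega
    · simp only at hlt'
      split_ifs at hlt' <;> omega
    · simp only at hlt
      split_ifs at hlt <;> omega
    · simp only at hlt
      split_ifs at hlt <;> omega
    · rw [segmentTree_adj_inr_inl] at hxy hxz
      simp only [Subtype.mk.injEq, Sum.inl.injEq, Fin.ext_iff]
      omega
    · exact absurd hxz not_segmentTree_adj_inr_inr
    · exact absurd hxy not_segmentTree_adj_inr_inr
    · exact absurd hxy not_segmentTree_adj_inr_inr

theorem segmentTree_connected : (segmentTree h i j L).coe.Connected := by
  set T := segmentTree h i j L with hT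
  have step : ∀ {x y} (hx : x ∈ T.verts) (hy : y ∈ T.verts), T.Adj x y →
      T.coe.Reachable ⟨pu n s h, pu_mem_segmentTree_verts⟩ ⟨x, hx⟩ →
      T.coe.Reachable ⟨pu n s h, pu_mem_segmentTree_verts⟩ ⟨y, hy⟩ :=
    fun hx hy hxy hr => hr.trans (SimpleGraph.Adj.reachable (by simpa using hxy))
  have low : ∀ (k : ℕ) (hk : k < n - 2 * s), (⟨k, hk⟩ : Fin (n - 2 * s)) ≤ i →
      ∀ hx, T.coe.Reachable ⟨pu n s h, pu_mem_segmentTree_verts⟩ ⟨Sum.inl ⟨k, hk⟩, hx⟩ := by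
    intro k
    induction k with
    | zero => intro _ _ _; rfl
    | succ k ih =>
      intro hk hki hx
      have hk' : (⟨k, by omega⟩ : Fin (n - 2 * s)) ≤ i := le_trans (by simp) hki
      exact step (inl_mem_segmentTree_verts.2 (Or.inl hk')) hx
        (segmentTree_adj_inl_inl.2 (Or.inl ⟨rfl, Or.inl hki⟩)) (ih _ hk' _)
  have high : ∀ (d k : ℕ) (hk : k < n - 2 * s), k + d + 1 = n - 2 * s →
      j ≤ (⟨k, hk⟩ : Fin (n - 2 * s)) →
      ∀ hx, T.coe.Reachable ⟨pu n s h, pu_mem_segmentTree_verts⟩ ⟨Sum.inl ⟨k, hk⟩, hx⟩ := by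
    intro d
    induction d with
    | zero =>
      intro k hk hd _ hx
      exact step pu_mem_segmentTree_verts hx
        (segmentTree_adj_inl_inl.2 (Or.inr (Or.inr (Or.inl ⟨rfl, by simp only; omega⟩)))) (by rfl)
    | succ d ih =>
      intro k hk hd hjk hx
      have hk' : j ≤ (⟨k + 1, by omega⟩ : Fin (n - 2 * s)) := hjk.trans (by simp)
      exact step (inl_mem_segmentTree_verts.2 (Or.inr hk')) hx
        (segmentTree_adj_inl_inl.2 (Or.inr (Or.inl ⟨rfl, Or.inr hjk⟩))) (ih _ _ (by omega) hk' _)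
  have path : ∀ (a : Fin (n - 2 * s)) (hx : Sum.inl a ∈ T.verts),
      T.coe.Reachable ⟨pu n s h, pu_mem_segmentTree_verts⟩ ⟨Sum.inl a, hx⟩ := by
    intro a hx
    rcases inl_mem_segmentTree_verts.1 hx with ha | ha
    · exact low a a.2 ha hx
    · exact high (n - 2 * s - 1 - a) a a.2 (by omega) ha hx
  rw [SimpleGraph.connected_iff_exists_forall_reachable]
  refine ⟨⟨pu n s h, pu_mem_segmentTree_verts⟩, ?_⟩
  rintro ⟨a | x, hx⟩
  · exact path a hx
  · have hb : leafBase n s x < n - 2 * s := by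
      have := leafBase_eq n s x
      omega
    have hadj : T.Adj (Sum.inl ⟨leafBase n s x, hb⟩) (Sum.inr x) :=
      segmentTree_adj_inl_inr.2 ⟨rfl, hx⟩
    exact step (T.edge_vert hadj) hx hadj (path _ _)

end segmentTree

theorem segmentTree_injOn :
    Set.InjOn (fun p : (Fin (n - 2 * s) × Fin (n - 2 * s)) × Finset (Fin s ⊕ Fin s) =>
      segmentTree h p.1.1 p.1.2 p.2) {p | p.1.1 < p.1.2} := by
  rintro ⟨⟨i, j⟩, L⟩ hij ⟨⟨i', j'⟩, L'⟩ hij' heq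
  simp only [Set.mem_ofPred_eq, Fin.lt_def] at hij hij' heq
  have hL : L = L' := by
    ext x
    rw [← inr_mem_segmentTree_verts (h := h) (i := i) (j := j), heq, inr_mem_segmentTree_verts]
  have hP : ∀ (a : ℕ), a + 1 < n - 2 * s →
      ((a + 1 ≤ (i : ℕ) ∨ (j : ℕ) ≤ a) ↔ (a + 1 ≤ (i' : ℕ) ∨ (j' : ℕ) ≤ a)) := by
    intro a ha
    have key : (segmentTree h i j L).Adj (Sum.inl ⟨a, by omega⟩) (Sum.inl ⟨a + 1, ha⟩) ↔
        (segmentTree h i' j' L').Adj (Sum.inl ⟨a, by omega⟩) (Sum.inl ⟨a + 1, ha⟩) := by rw [heq]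
    simp only [segmentTree_adj_inl_inl, Fin.le_def, true_and] at key
    omega
  have h1 := hP i (by omega)
  have h2 := hP i' (by omega)
  have h3 := hP (j - 1) (by omega)
  have h4 := hP (j' - 1) (by omega)
  simp only [Prod.mk.injEq, Fin.ext_iff]
  exact ⟨by omega, hL⟩

/-- In an acyclic subgraph containing the added edge, some edge of the path is missing. -/
theorem exists_not_adj_of_isAcyclic {H : (Gns n s h).Subgraph} (hH : H.coe.IsAcyclic)
    (he : H.Adj (pu n s h) (pv n s h)) :
    ∃ (k : ℕ) (hk : k + 1 < n - 2 * s),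
      ¬ H.Adj (Sum.inl ⟨k, by omega⟩) (Sum.inl ⟨k + 1, hk⟩) := by
  by_contra! hall
  have hadj : H.coe.Adj ⟨_, H.edge_vert he⟩ ⟨_, H.edge_vert he.symm⟩ := he
  have hbr := SimpleGraph.isAcyclic_iff_forall_adj_isBridge.1 hH hadj
  rw [SimpleGraph.isBridge_iff] at hbr
  have reach : ∀ (k : ℕ) (hk : k < n - 2 * s), ∃ hx,
      (H.coe \ SimpleGraph.fromEdgeSet {s(⟨_, H.edge_vert he⟩, ⟨_, H.edge_vert he.symm⟩)}).Reachable
        ⟨_, H.edge_vert he⟩ ⟨Sum.inl ⟨k, hk⟩, hx⟩ := by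
    intro k
    induction k with
    | zero => exact fun hk => ⟨H.edge_vert he, by rfl⟩
    | succ k ih =>
      intro hk
      obtain ⟨hx, hr⟩ := ih (by omega)
      have hk' := hall k hk
      refine ⟨H.edge_vert hk'.symm, hr.trans (SimpleGraph.Adj.reachable ?_)⟩
      simp only [SimpleGraph.sdiff_adj, SimpleGraph.Subgraph.coe_adj, hk', true_and,
        SimpleGraph.fromEdgeSet_adj, Set.mem_singleton_iff, Sym2.eq_iff, Subtype.mk.injEq, pu, pv,
        Sum.inl.injEq, Fin.ext_iff]
      omega
  obtain ⟨_, hr⟩ := reach (n - 2 * s - 1) (by omega)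
  exact hbr hr

/-- A connected subgraph all of whose edges stay inside or outside `S`, and which has a vertex
outside `S`, avoids `S`. -/
theorem notMem_verts_of_closed {V : Type*} {G : SimpleGraph V} {H : G.Subgraph}
    (hH : H.coe.Connected) {S : Set V} {u x : V} (hu : u ∈ H.verts) (huS : u ∉ S)
    (hS : ∀ y z, H.Adj y z → y ∉ S → z ∉ S) (hxS : x ∈ S) : x ∉ H.verts := by
  intro hx
  obtain ⟨w⟩ := hH.preconnected ⟨u, hu⟩ ⟨x, hx⟩
  have : ∀ {a b : H.verts}, H.coe.Walk a b → a.1 ∉ S → b.1 ∉ S := by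
    intro a b w
    induction w with
    | nil => exact id
    | cons hab _ ih => exact fun ha => ih (hS _ _ hab ha)
  exact this w huS hxS

theorem exists_eq_segmentTree {H : (Gns n s h).Subgraph} (hH : H.coe.IsTree)
    (he : H.Adj (pu n s h) (pv n s h)) : ∃ i j L, i < j ∧ segmentTree h i j L = H := by
  classical
  let P : ℕ → Prop := fun k =>
    ∃ hk : k + 1 < n - 2 * s, ¬ H.Adj (Sum.inl ⟨k, by omega⟩) (Sum.inl ⟨k + 1, hk⟩)
  have hP : ∃ k, P k := exists_not_adj_of_isAcyclic hH.isAcyclic he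
  have hlt : ∀ k, P k → k + 1 < n - 2 * s := fun k hk => hk.1
  obtain ⟨i, hi, hmin⟩ : ∃ i, P i ∧ ∀ k, P k → i ≤ k :=
    ⟨Nat.find hP, Nat.find_spec hP, fun k hk => Nat.find_min' hP hk⟩
  obtain ⟨j, hj, hmax⟩ : ∃ j, P j ∧ ∀ k, P k → k ≤ j :=
    ⟨Nat.findGreatest P n, Nat.findGreatest_spec (P := P) (by have := hlt i hi; omega) hi,
      fun k hk => Nat.le_findGreatest (by have := hlt k hk; omega) hk⟩
  have hin := hlt i hi
  have hjn := hlt j hj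
  have hij := hmin j hj
  have adj_iff : ∀ a b : Fin (n - 2 * s), (a : ℕ) + 1 = b → ¬ P a →
      H.Adj (Sum.inl a) (Sum.inl b) := by
    rintro ⟨a, ha⟩ ⟨b, hb⟩ hab hPa
    simp only at hab hPa
    subst hab
    by_contra hcon
    exact hPa ⟨hb, hcon⟩
  have not_adj : ∀ a b : Fin (n - 2 * s), (a : ℕ) + 1 = b → P a →
      ¬ H.Adj (Sum.inl a) (Sum.inl b) := by
    rintro ⟨a, ha⟩ ⟨b, hb⟩ hab hPa
    simp only at hab hPa
    subst hab
    exact hPa.2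
  have gap : ∀ a : Fin (n - 2 * s), i < (a : ℕ) → (a : ℕ) < j + 1 → Sum.inl a ∉ H.verts := by
    intro a hia haj
    refine notMem_verts_of_closed hH.connected
      (S := {x | ∃ a : Fin (n - 2 * s), x = Sum.inl a ∧ i < (a : ℕ) ∧ (a : ℕ) < j + 1})
      (H.edge_vert he) ?_ ?_ ⟨a, rfl, hia, haj⟩
    · rintro ⟨b, hb, hb', -⟩
      simp only [pu, Sum.inl.injEq] at hb
      subst hb
      simp at hb'
    · rintro y z hyz hy ⟨c, rfl, hc, hc'⟩
      rcases y with b | x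
      · have hb : ¬ (i < (b : ℕ) ∧ (b : ℕ) < j + 1) := fun hb => hy ⟨b, rfl, hb⟩
        rcases (Gns_adj_inl_inl _ _).1 hyz.adj_sub with hbc | hbc | hbc | hbc
        · exact not_adj b c hbc (by rwa [show (b : ℕ) = i by omega]) hyz
        · exact not_adj c b hbc (by rwa [show (c : ℕ) = j by omega]) hyz.symm
        · omega
        · omega
      · have := (Gns_adj_inr_inl _ _).1 hyz.adj_sub
        have := leafBase_eq n s x
        omega
  have leaf : ∀ (a : Fin (n - 2 * s)) (x : Fin s ⊕ Fin s), (a : ℕ) = leafBase n s x →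
      Sum.inr x ∈ H.verts → H.Adj (Sum.inl a) (Sum.inr x) := by
    intro a x hax hx
    by_contra hcon
    refine notMem_verts_of_closed hH.connected (S := {Sum.inr x}) (H.edge_vert he)
      (by simp [pu]) ?_ rfl hx
    rintro (b | y) z hyz - rfl
    · have hbx := (Gns_adj_inl_inr _ _).1 hyz.adj_sub
      rw [Fin.ext (hbx.trans hax.symm)] at hyz
      exact hcon hyz
    · exact not_Gns_adj_inr_inr _ _ hyz.adj_sub
  have edge : ∀ a b : Fin (n - 2 * s), (a : ℕ) = 0 → (b : ℕ) = n - 2 * s - 1 →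
      H.Adj (Sum.inl a) (Sum.inl b) := by
    rintro ⟨a, ha⟩ ⟨b, hb⟩ rfl rfl
    exact he
  have succ_adj : ∀ a b : Fin (n - 2 * s), (a : ℕ) + 1 = b →
      (H.Adj (Sum.inl a) (Sum.inl b) ↔ ((b : ℕ) ≤ i ∨ j + 1 ≤ (a : ℕ))) := by
    intro a b hab
    constructor
    · intro hadj
      by_contra! hcon
      by_cases hai : (a : ℕ) = i
      · exact not_adj a b hab (by rwa [hai]) hadj
      · exact gap a (by omega) (by omega) (H.edge_vert hadj)
    · intro hor
      refine adj_iff a b hab fun hPa => ?_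
      have := hmin _ hPa
      have := hmax _ hPa
      omega
  have mem_iff : ∀ a : Fin (n - 2 * s),
      Sum.inl a ∈ H.verts ↔ ((a : ℕ) ≤ i ∨ j + 1 ≤ (a : ℕ)) := by
    intro a
    constructor
    · intro ha
      by_contra! hcon
      exact gap a hcon.1 hcon.2 ha
    · rintro (ha | ha)
      · by_cases ha0 : (a : ℕ) = 0
        · exact H.edge_vert (edge a ⟨n - 2 * s - 1, by omega⟩ ha0 rfl)
        · exact H.edge_vert ((succ_adj ⟨a - 1, by omega⟩ a (by simp only; omega)).2
            (Or.inl ha)).symm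
      · by_cases ha0 : (a : ℕ) = n - 2 * s - 1
        · exact H.edge_vert (edge ⟨0, by omega⟩ a rfl ha0).symm
        · exact H.edge_vert ((succ_adj a ⟨a + 1, by omega⟩ rfl).2 (Or.inr ha))
  refine ⟨⟨i, by omega⟩, ⟨j + 1, by omega⟩, Finset.univ.filter fun x => Sum.inr x ∈ H.verts,
    by simp only [Fin.lt_def]; omega, ?_⟩
  refine SimpleGraph.Subgraph.ext ?_ ?_
  · ext (a | x)
    · rw [inl_mem_segmentTree_verts, mem_iff, Fin.le_def, Fin.le_def]
    · simp [inr_mem_segmentTree_verts]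
  · ext (a | x) (b | y)
    · rw [segmentTree_adj_inl_inl]
      simp only [Fin.le_def]
      constructor
      · rintro (hab | hab | hab | hab)
        · exact (succ_adj a b hab.1).2 hab.2
        · exact ((succ_adj b a hab.1).2 hab.2).symm
        · exact edge a b hab.1 hab.2
        · exact (edge b a hab.1 hab.2).symm
      · intro hadj
        rcases (Gns_adj_inl_inl _ _).1 hadj.adj_sub with hab | hab | hab | hab
        · exact Or.inl ⟨hab, (succ_adj a b hab).1 hadj⟩
        · exact Or.inr (Or.inl ⟨hab, (succ_adj b a hab).1 hadj.symm⟩)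
        · exact Or.inr (Or.inr (Or.inl hab))
        · exact Or.inr (Or.inr (Or.inr hab))
    · rw [segmentTree_adj_inl_inr]
      simp only [Finset.mem_filter, Finset.mem_univ, true_and]
      exact ⟨fun hy => leaf a y hy.1 hy.2,
        fun hadj => ⟨(Gns_adj_inl_inr _ _).1 hadj.adj_sub, H.edge_vert hadj.symm⟩⟩
    · rw [segmentTree_adj_inr_inl]
      simp only [Finset.mem_filter, Finset.mem_univ, true_and]
      exact ⟨fun hx => (leaf b x hx.1 hx.2).symm,
        fun hadj => ⟨(Gns_adj_inr_inl _ _).1 hadj.adj_sub, H.edge_vert hadj⟩⟩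
    · exact iff_of_false not_segmentTree_adj_inr_inr
        fun hadj => not_Gns_adj_inr_inr _ _ hadj.adj_sub

end

theorem card_filter_lt_fin (m : ℕ) :
    (Finset.univ.filter fun p : Fin m × Fin m => p.1 < p.2).card = m * (m - 1) / 2 := by
  rw [Finset.card_filter, ← Finset.univ_product_univ, Finset.sum_product_right]
  simp_rw [← Finset.card_filter, Finset.filter_gt_eq_Iio, Fin.card_Iio]
  rw [Fin.sum_univ_eq_sum_range (fun k => k), Finset.sum_range_id]

/-- For `2s ≤ n - 3`, the number of subtrees of `G_{n,s}` containing the added edge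
`e = uv` is `C(n - 2s, 2) · 2^{2s}`, where `C(m, 2) = m(m-1)/2`. -/
theorem card_subtrees_Gns_containing_edge (n s : ℕ) (h : 2 * s + 3 ≤ n) :
    {H ∈ subtrees (Gns n s h) | s(pu n s h, pv n s h) ∈ H.edgeSet}.ncard
      = (n - 2 * s) * (n - 2 * s - 1) / 2 * 2 ^ (2 * s) := by
  have himg : {H ∈ subtrees (Gns n s h) | s(pu n s h, pv n s h) ∈ H.edgeSet} =
      (fun p : (Fin (n - 2 * s) × Fin (n - 2 * s)) × Finset (Fin s ⊕ Fin s) =>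
        segmentTree h p.1.1 p.1.2 p.2) '' {p | p.1.1 < p.1.2} := by
    ext H
    constructor
    · rintro ⟨hH, he⟩
      obtain ⟨i, j, L, hij, rfl⟩ := exists_eq_segmentTree hH he
      exact ⟨((i, j), L), hij, rfl⟩
    · rintro ⟨⟨⟨i, j⟩, L⟩, hij, rfl⟩
      exact ⟨⟨segmentTree_connected, segmentTree_isAcyclic hij⟩,
        segmentTree_adj_pu_pv (h := h) (L := L)⟩
  have hset : {p : (Fin (n - 2 * s) × Fin (n - 2 * s)) × Finset (Fin s ⊕ Fin s) |
      p.1.1 < p.1.2} =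
      ↑((Finset.univ.filter fun p : Fin (n - 2 * s) × Fin (n - 2 * s) => p.1 < p.2) ×ˢ
        (Finset.univ : Finset (Finset (Fin s ⊕ Fin s)))) := by
    ext p
    simp
  rw [himg, segmentTree_injOn.ncard_image, hset, Set.ncard_coe_finset,
    Finset.card_product, card_filter_lt_fin, Finset.card_univ, Fintype.card_finset,
    Fintype.card_sum, Fintype.card_fin, two_mul s]

end SubtreePaper
end
end

section
/- Let n and s be nonnegative integers with 2s ≤ n − 3. Let T_{n,s} be the tree obtained from a path of order n − 2s with endvertices u and v by attaching s new leaves to u and s new leaves to v. Then the total number of subtrees of T_{n,s} equals 2s + C(n−2s−1, 2) + 2(n−2s−1)·2^{s} + 2^{2s}, where C(m,2) = m(m−1)/2. -/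
open Filter Topology

noncomputable section

namespace SubtreePaper

open SimpleGraph

section General

variable {V : Type*} {G : SimpleGraph V}

/-- A reachable pair separated by a vertex set forces an edge crossing that set. -/
lemma exists_adj_mem_notMem {u v : V} (h : G.Reachable u v) (S : Set V)
    (hu : u ∈ S) (hv : v ∉ S) : ∃ x y, G.Adj x y ∧ x ∈ S ∧ y ∉ S := by
  obtain ⟨p⟩ := h
  obtain ⟨d, -, h₁, h₂⟩ := p.exists_boundary_dart S hu hv
  exact ⟨d.fst, d.snd, d.adj, h₁, h₂⟩

/-- The version of `exists_adj_mem_notMem` for a connected induced subgraph. -/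
lemma exists_adj_mem_notMem_of_connected_induce {T : Set V} (h : (G.induce T).Connected)
    (S : Set V) {u v : V} (huT : u ∈ T) (hvT : v ∈ T) (hu : u ∈ S) (hv : v ∉ S) :
    ∃ x ∈ T, ∃ y ∈ T, G.Adj x y ∧ x ∈ S ∧ y ∉ S := by
  obtain ⟨x, y, hxy, hx, hy⟩ := exists_adj_mem_notMem (h.preconnected ⟨u, huT⟩ ⟨v, hvT⟩)
    (Subtype.val ⁻¹' S) hu hv
  exact ⟨x, x.2, y, y.2, hxy, hx, hy⟩

/-- A connected subgraph of a forest is an induced subgraph. -/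
lemma isInduced_of_isAcyclic (hG : G.IsAcyclic) {H : G.Subgraph} (hH : H.coe.Connected) :
    H.IsInduced := by
  intro a ha b hb hab
  by_contra hn
  have hbr := isAcyclic_iff_forall_adj_isBridge.1 hG hab
  refine isBridge_iff.1 hbr ((hH.preconnected ⟨a, ha⟩ ⟨b, hb⟩).map
    (⟨Subtype.val, fun {x y} hxy => ?_⟩ : H.coe →g G.deleteEdges {s(a, b)}))
  have hxy' : H.Adj x y := hxy
  rw [deleteEdges_adj]
  refine ⟨hxy'.adj_sub, fun he => hn ?_⟩
  rcases Sym2.eq_iff.1 (Set.mem_singleton_iff.1 he) with ⟨h₁, h₂⟩ | ⟨h₁, h₂⟩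
  · rwa [← h₁, ← h₂]
  · rw [← h₁, ← h₂]; exact hxy'.symm

/-- The subtrees of a forest correspond to the vertex sets inducing a connected subgraph. -/
lemma numSubtrees_eq_ncard_connected (hG : G.IsAcyclic) :
    numSubtrees G = {S : Set V | (G.induce S).Connected}.ncard := by
  refine Set.ncard_congr (fun H _ => H.verts) ?_ ?_ ?_
  · intro H hH
    have hH' : H.coe.IsTree := hH
    exact hH'.connected.mono fun x y hxy => H.adj_sub hxy
  · intro H K hH hK hHK
    have hHi := isInduced_of_isAcyclic hG (IsTree.connected hH)
    have hKi := isInduced_of_isAcyclic hG (IsTree.connected hK)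
    have hHK' : H.verts = K.verts := hHK
    refine Subgraph.ext hHK' ?_
    ext a b
    refine ⟨fun h => hKi (hHK' ▸ h.fst_mem) (hHK' ▸ h.snd_mem) h.adj_sub,
      fun h => hHi (hHK' ▸ h.fst_mem) (hHK' ▸ h.snd_mem) h.adj_sub⟩
  · intro S hS
    refine ⟨(⊤ : G.Subgraph).induce S, ?_, rfl⟩
    have hc : ((⊤ : G.Subgraph).induce S).coe.Connected :=
      (Subgraph.connected_iff' (H := (⊤ : G.Subgraph).induce S)).1
        (connected_induce_iff.1 hS)
    exact ⟨hc, hG.subgraph _⟩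

/-- A graph in which every edge is the only edge crossing some cut is acyclic. -/
lemma isAcyclic_of_forall_adj_exists_cut
    (h : ∀ a b, G.Adj a b → ∃ S : Set V, a ∈ S ∧ b ∉ S ∧
      ∀ x y, G.Adj x y → x ∈ S → y ∉ S → x = a ∧ y = b) : G.IsAcyclic := by
  refine isAcyclic_iff_forall_adj_isBridge.2 fun a b hab => isBridge_iff.2 fun hr => ?_
  obtain ⟨S, ha, hb, hS⟩ := h a b hab
  obtain ⟨x, y, hxy, hx, hy⟩ := exists_adj_mem_notMem hr S ha hb
  rw [deleteEdges_adj] at hxy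
  obtain ⟨rfl, rfl⟩ := hS x y hxy.1 hx hy
  exact hxy.2 rfl

end General

section Adjacency

variable {n s : ℕ}

@[simp] lemma Tns_adj_inl_inl (i j : Fin (n - 2 * s)) :
    (Tns n s).Adj (Sum.inl i) (Sum.inl j) ↔ (i : ℕ) + 1 = j ∨ (j : ℕ) + 1 = i := by
  simp only [Tns, fromRel_adj, ne_eq, Sum.inl.injEq, Fin.ext_iff]
  omega

@[simp] lemma Tns_adj_inl_inr_inl (i : Fin (n - 2 * s)) (j : Fin s) :
    (Tns n s).Adj (Sum.inl i) (Sum.inr (Sum.inl j)) ↔ (i : ℕ) = 0 := by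
  simp [Tns]

@[simp] lemma Tns_adj_inl_inr_inr (i : Fin (n - 2 * s)) (j : Fin s) :
    (Tns n s).Adj (Sum.inl i) (Sum.inr (Sum.inr j)) ↔ (i : ℕ) = n - 2 * s - 1 := by
  simp [Tns]

@[simp] lemma Tns_adj_inr_inl_inl (i : Fin (n - 2 * s)) (j : Fin s) :
    (Tns n s).Adj (Sum.inr (Sum.inl j)) (Sum.inl i) ↔ (i : ℕ) = 0 := by
  simp [Tns]

@[simp] lemma Tns_adj_inr_inr_inl (i : Fin (n - 2 * s)) (j : Fin s) :
    (Tns n s).Adj (Sum.inr (Sum.inr j)) (Sum.inl i) ↔ (i : ℕ) = n - 2 * s - 1 := by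
  simp [Tns]

@[simp] lemma Tns_not_adj_inr_inr (x y : Fin s ⊕ Fin s) :
    ¬ (Tns n s).Adj (Sum.inr x) (Sum.inr y) := by
  simp [Tns]

/-- The vertices of `T_{n,s}` on the side of `u` of the path edge from `i` to `i + 1`. -/
def leftSide (n s i : ℕ) : Set (Fin (n - 2 * s) ⊕ Fin s ⊕ Fin s) :=
  {x | match x with
    | Sum.inl k => (k : ℕ) ≤ i
    | Sum.inr (Sum.inl _) => True
    | Sum.inr (Sum.inr _) => False}

@[simp] lemma inl_mem_leftSide {i : ℕ} (k : Fin (n - 2 * s)) :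
    Sum.inl k ∈ leftSide n s i ↔ (k : ℕ) ≤ i := Iff.rfl

@[simp] lemma inr_inl_mem_leftSide {i : ℕ} (j : Fin s) :
    Sum.inr (Sum.inl j) ∈ leftSide n s i := trivial

@[simp] lemma inr_inr_notMem_leftSide {i : ℕ} (j : Fin s) :
    Sum.inr (Sum.inr j) ∉ leftSide n s i := id

/-- Only one edge of `T_{n,s}` leaves `leftSide n s i`. -/
lemma eq_of_adj_of_mem_leftSide {i : ℕ} (hi : i + 1 < n - 2 * s)
    {x y : Fin (n - 2 * s) ⊕ Fin s ⊕ Fin s} (hxy : (Tns n s).Adj x y)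
    (hx : x ∈ leftSide n s i) (hy : y ∉ leftSide n s i) :
    x = Sum.inl ⟨i, by omega⟩ ∧ y = Sum.inl ⟨i + 1, hi⟩ := by
  rcases x with x | x | x <;> rcases y with y | y | y <;>
    simp [Fin.ext_iff] at hxy hx hy ⊢ <;> omega

/-- A leaf of `T_{n,s}` has at most one neighbour. -/
lemma eq_of_adj_inr {l : Fin s ⊕ Fin s} {x y : Fin (n - 2 * s) ⊕ Fin s ⊕ Fin s}
    (hx : (Tns n s).Adj (Sum.inr l) x) (hy : (Tns n s).Adj (Sum.inr l) y) : x = y := by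
  rcases l with l | l <;> rcases x with x | x | x <;> rcases y with y | y | y <;>
    simp [Fin.ext_iff] at hx hy ⊢ <;> omega

lemma Tns_isAcyclic (n s : ℕ) : (Tns n s).IsAcyclic := by
  refine isAcyclic_of_forall_adj_exists_cut fun a b hab => ?_
  rcases a with i | l
  · rcases b with j | l
    · have hi := i.2
      have hj := j.2
      rcases (Tns_adj_inl_inl i j).1 hab with hij | hij
      · refine ⟨leftSide n s i, by simp, by simp; omega, fun x y hxy hx hy => ?_⟩
        obtain ⟨rfl, rfl⟩ := eq_of_adj_of_mem_leftSide (by omega) hxy hx hy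
        simp [hij]
      · refine ⟨(leftSide n s j)ᶜ, by simp; omega, by simp, fun x y hxy hx hy => ?_⟩
        obtain ⟨rfl, rfl⟩ := eq_of_adj_of_mem_leftSide (by omega) hxy.symm (not_not.1 hy) hx
        simp [hij]
    · refine ⟨{Sum.inr l}ᶜ, by simp, by simp, fun x y hxy _ hy => ?_⟩
      obtain rfl : y = Sum.inr l := not_not.1 hy
      exact ⟨eq_of_adj_inr hxy.symm hab.symm, rfl⟩
  · refine ⟨{Sum.inr l}, rfl, hab.ne', fun x y hxy hx _ => ?_⟩
    obtain rfl : x = Sum.inr l := hx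
    exact ⟨rfl, eq_of_adj_inr hxy hab⟩

end Adjacency

section Counting

/-- The union of the segment of the path between `a` and `b`, the leaves at `u` indexed by `A`
and the leaves at `v` indexed by `B`. -/
def segmentWithLeaves (n s a b : ℕ) (A B : Finset (Fin s)) :
    Set (Fin (n - 2 * s) ⊕ Fin s ⊕ Fin s) :=
  {x | match x with
    | Sum.inl k => a ≤ (k : ℕ) ∧ (k : ℕ) ≤ b
    | Sum.inr (Sum.inl j) => j ∈ A
    | Sum.inr (Sum.inr j) => j ∈ B}

variable {n s : ℕ}

@[simp] lemma inl_mem_segmentWithLeaves {a b : ℕ} {A B : Finset (Fin s)} (k : Fin (n - 2 * s)) :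
    Sum.inl k ∈ segmentWithLeaves n s a b A B ↔ a ≤ (k : ℕ) ∧ (k : ℕ) ≤ b := Iff.rfl

@[simp] lemma inr_inl_mem_segmentWithLeaves {a b : ℕ} {A B : Finset (Fin s)} (j : Fin s) :
    Sum.inr (Sum.inl j) ∈ segmentWithLeaves n s a b A B ↔ j ∈ A := Iff.rfl

@[simp] lemma inr_inr_mem_segmentWithLeaves {a b : ℕ} {A B : Finset (Fin s)} (j : Fin s) :
    Sum.inr (Sum.inr j) ∈ segmentWithLeaves n s a b A B ↔ j ∈ B := Iff.rfl

/-- The parameters `(b, a, A, B)` for which `segmentWithLeaves n s a b A B` is nonempty and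
connected. -/
def segmentCodes (n s : ℕ) : Finset (ℕ × ℕ × Finset (Fin s) × Finset (Fin s)) :=
  (Finset.range (n - 2 * s)).biUnion fun b => (Finset.range (b + 1)).biUnion fun a =>
    {b} ×ˢ {a} ×ˢ (if a = 0 then Finset.univ else {∅}) ×ˢ
      (if b = n - 2 * s - 1 then Finset.univ else {∅})

lemma mem_segmentCodes {a b : ℕ} {A B : Finset (Fin s)} :
    (b, a, A, B) ∈ segmentCodes n s ↔ b < n - 2 * s ∧ a ≤ b ∧ (a ≠ 0 → A = ∅) ∧
      (b ≠ n - 2 * s - 1 → B = ∅) := by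
  simp only [segmentCodes, Finset.mem_biUnion, Finset.mem_range, Finset.mem_product,
    Finset.mem_singleton]
  constructor
  · rintro ⟨b', hb', a', ha', rfl, rfl, hA, hB⟩
    refine ⟨hb', by omega, fun h => ?_, fun h => ?_⟩
    · simpa [h] using hA
    · simpa [h] using hB
  · rintro ⟨hb, ha, hA, hB⟩
    refine ⟨b, hb, a, by omega, rfl, rfl, ?_, ?_⟩
    · split_ifs with h <;> simp [hA, h]
    · split_ifs with h <;> simp [hB, h]

lemma card_segmentCodes (h : 2 * s + 1 ≤ n) :
    (segmentCodes n s).card = (n - 2 * s - 1) * (n - 2 * s - 2) / 2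
      + 2 * (n - 2 * s - 1) * 2 ^ s + 2 ^ (2 * s) := by
  obtain ⟨m, hm⟩ : ∃ m, n - 2 * s = m + 1 := ⟨n - 2 * s - 1, by omega⟩
  have hcard : (segmentCodes n s).card = ∑ b ∈ Finset.range (n - 2 * s),
      ∑ a ∈ Finset.range (b + 1), (if a = 0 then 2 ^ s else 1) *
        (if b = n - 2 * s - 1 then 2 ^ s else 1) := by
    rw [segmentCodes, Finset.card_biUnion]
    · refine Finset.sum_congr rfl fun b _ => ?_
      rw [Finset.card_biUnion]
      · refine Finset.sum_congr rfl fun a _ => ?_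
        simp only [Finset.card_product, Finset.card_singleton, one_mul]
        congr 1 <;> split_ifs <;> simp
      · intro a _ a' _ haa'
        rw [Function.onFun, Finset.disjoint_left]
        rintro ⟨x, y, z⟩ h₁ h₂
        simp only [Finset.mem_product, Finset.mem_singleton] at h₁ h₂
        exact haa' (h₁.2.1.symm.trans h₂.2.1)
    · intro b _ b' _ hbb'
      rw [Function.onFun, Finset.disjoint_left]
      rintro ⟨x, y, z⟩ h₁ h₂
      simp only [Finset.mem_biUnion, Finset.mem_product, Finset.mem_singleton] at h₁ h₂
      obtain ⟨_, _, h₁, _⟩ := h₁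
      obtain ⟨_, _, h₂, _⟩ := h₂
      exact hbb' (h₁.symm.trans h₂)
  have hinner (b : ℕ) : ∑ a ∈ Finset.range (b + 1), (if a = 0 then 2 ^ s else 1) = 2 ^ s + b := by
    rw [Finset.sum_range_succ']
    simp [add_comm]
  simp_rw [hcard, ← Finset.sum_mul, hinner, hm]
  rw [Finset.sum_range_succ]
  have hlow : ∑ b ∈ Finset.range m, (2 ^ s + b) * (if b = m + 1 - 1 then 2 ^ s else 1)
      = m * 2 ^ s + m * (m - 1) / 2 := by
    calc _ = ∑ b ∈ Finset.range m, (2 ^ s + b) := Finset.sum_congr rfl fun b hb => by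
          rw [if_neg (by have := Finset.mem_range.1 hb; omega), mul_one]
      _ = m * 2 ^ s + m * (m - 1) / 2 := by
          rw [Finset.sum_add_distrib, Finset.sum_range_id, Finset.sum_const, Finset.card_range,
            smul_eq_mul]
  rw [hlow, show m + 1 - 1 = m by omega, show m + 1 - 2 = m - 1 by omega]
  simp only [if_true]
  ring

lemma segmentWithLeaves_injOn : Set.InjOn
    (fun c : ℕ × ℕ × Finset (Fin s) × Finset (Fin s) =>
      segmentWithLeaves n s c.2.1 c.1 c.2.2.1 c.2.2.2) (segmentCodes n s) := by
  rintro ⟨b, a, A, B⟩ h₁ ⟨b', a', A', B'⟩ h₂ heq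
  obtain ⟨hb, ha, -, -⟩ := mem_segmentCodes.1 h₁
  obtain ⟨hb', ha', -, -⟩ := mem_segmentCodes.1 h₂
  have key := fun x => Set.ext_iff.1 heq x
  have hA : A = A' := Finset.ext fun j => key (Sum.inr (Sum.inl j))
  have hB : B = B' := Finset.ext fun j => key (Sum.inr (Sum.inr j))
  have k₁ := (key (Sum.inl ⟨a, by omega⟩)).1 ⟨le_rfl, ha⟩
  have k₂ := (key (Sum.inl ⟨b, by omega⟩)).1 ⟨ha, le_rfl⟩
  have k₃ := (key (Sum.inl ⟨a', by omega⟩)).2 ⟨le_rfl, ha'⟩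
  have k₄ := (key (Sum.inl ⟨b', by omega⟩)).2 ⟨ha', le_rfl⟩
  simp only [inl_mem_segmentWithLeaves] at k₁ k₂ k₃ k₄
  obtain rfl : a = a' := by omega
  obtain rfl : b = b' := by omega
  rw [hA, hB]

lemma connected_segmentWithLeaves {a b : ℕ} {A B : Finset (Fin s)}
    (h : (b, a, A, B) ∈ segmentCodes n s) :
    ((Tns n s).induce (segmentWithLeaves n s a b A B)).Connected := by
  obtain ⟨hb, ha, hA, hB⟩ := mem_segmentCodes.1 h
  have hmem (k : ℕ) (h₁ : a ≤ k) (h₂ : k ≤ b) :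
      Sum.inl ⟨k, by omega⟩ ∈ segmentWithLeaves n s a b A B := ⟨h₁, h₂⟩
  have hpath (k : ℕ) (h₁ : a ≤ k) : ∀ h₂ : k ≤ b,
      ((Tns n s).induce (segmentWithLeaves n s a b A B)).Reachable
        ⟨_, hmem a le_rfl ha⟩ ⟨_, hmem k h₁ h₂⟩ := by
    induction k, h₁ using Nat.le_induction with
    | base => exact fun _ => Reachable.refl _
    | succ k hk ih =>
      refine fun h₂ => (ih (by omega)).trans (Adj.reachable ?_)
      simp
  refine (connected_iff_exists_forall_reachable _).2 ⟨⟨_, hmem a le_rfl ha⟩, ?_⟩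
  rintro ⟨k | j | j, hx⟩
  · exact hpath k hx.1 hx.2
  · have ha0 : a = 0 := by
      by_contra h0
      simp [hA h0] at hx
    refine (hpath a le_rfl ha).trans (Adj.reachable ?_)
    simpa using ha0
  · have hbm : b = n - 2 * s - 1 := by
      by_contra h0
      simp [hB h0] at hx
    refine (hpath b ha le_rfl).trans (Adj.reachable ?_)
    simpa using hbm

/-- A connected vertex set meeting the path is a segment with leaves. -/
lemma exists_segmentCode_of_connected {S : Set (Fin (n - 2 * s) ⊕ Fin s ⊕ Fin s)}
    (hS : ((Tns n s).induce S).Connected) {k : Fin (n - 2 * s)} (hk : Sum.inl k ∈ S) :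
    ∃ c ∈ segmentCodes n s, segmentWithLeaves n s c.2.1 c.1 c.2.2.1 c.2.2.2 = S := by
  classical
  have hne : (Finset.univ.filter fun i : Fin (n - 2 * s) => Sum.inl i ∈ S).Nonempty :=
    ⟨k, by simpa using hk⟩
  obtain ⟨a, haS, hamin⟩ := Finset.exists_min_image _ id hne
  obtain ⟨b, hbS, hbmax⟩ := Finset.exists_max_image _ id hne
  simp only [Finset.mem_filter, Finset.mem_univ, true_and, id] at haS hamin hbS hbmax
  refine ⟨(b, a, Finset.univ.filter fun j => Sum.inr (Sum.inl j) ∈ S,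
    Finset.univ.filter fun j => Sum.inr (Sum.inr j) ∈ S),
    mem_segmentCodes.2 ⟨b.2, hamin b hbS, fun h0 => ?_, fun h0 => ?_⟩, ?_⟩
  · refine Finset.filter_eq_empty_iff.2 fun j _ hj => h0 ?_
    obtain ⟨x, hxS, y, hyS, hxy, hx, -⟩ := exists_adj_mem_notMem_of_connected_induce hS
      {Sum.inr (Sum.inl j)} hj hk rfl (by simp)
    obtain rfl : x = _ := hx
    rcases y with y | y | y <;> simp at hxy
    have : (a : ℕ) ≤ y := hamin y hyS
    omega
  · refine Finset.filter_eq_empty_iff.2 fun j _ hj => h0 ?_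
    obtain ⟨x, hxS, y, hyS, hxy, hx, -⟩ := exists_adj_mem_notMem_of_connected_induce hS
      {Sum.inr (Sum.inr j)} hj hk rfl (by simp)
    obtain rfl : x = _ := hx
    rcases y with y | y | y <;> simp at hxy
    have : (y : ℕ) ≤ b := hbmax y hyS
    omega
  · ext x
    rcases x with i | j | j
    · refine ⟨fun ⟨h₁, h₂⟩ => ?_, fun hi => ⟨hamin i hi, hbmax i hi⟩⟩
      rcases h₂.eq_or_lt with h₂ | h₂
      · rwa [Fin.ext h₂]
      · obtain ⟨x, hxS, y, hyS, hxy, hx, hy⟩ := exists_adj_mem_notMem_of_connected_induce hS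
          (leftSide n s i) haS hbS h₁ (by simpa using h₂)
        obtain ⟨rfl, -⟩ := eq_of_adj_of_mem_leftSide (by omega) hxy hx hy
        exact hxS
    · simp
    · simp

/-- A connected vertex set avoiding the path is a single leaf. -/
lemma exists_eq_singleton_of_connected {S : Set (Fin (n - 2 * s) ⊕ Fin s ⊕ Fin s)}
    (hS : ((Tns n s).induce S).Connected) (hk : ∀ k, Sum.inl k ∉ S) :
    ∃ l, {Sum.inr l} = S := by
  obtain ⟨⟨x | l, hx⟩⟩ := hS.nonempty
  · exact absurd hx (hk x)
  refine ⟨l, Set.eq_of_subset_of_subset (by simpa using hx) fun y hy => ?_⟩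
  by_contra hyl
  obtain ⟨x, -, z, hzS, hxz, hxl, -⟩ := exists_adj_mem_notMem_of_connected_induce hS
    {Sum.inr l} hx hy rfl hyl
  obtain rfl : x = _ := hxl
  rcases z with z | z
  · exact hk z hzS
  · exact Tns_not_adj_inr_inr _ _ hxz

/-- The connected vertex sets of `T_{n,s}`. -/
lemma setOf_connected_Tns : {S | ((Tns n s).induce S).Connected} =
    Set.range (fun l : Fin s ⊕ Fin s => ({Sum.inr l} : Set (Fin (n - 2 * s) ⊕ Fin s ⊕ Fin s))) ∪
    (fun c : ℕ × ℕ × Finset (Fin s) × Finset (Fin s) =>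
      segmentWithLeaves n s c.2.1 c.1 c.2.2.1 c.2.2.2) '' segmentCodes n s := by
  ext S
  constructor
  · intro hS
    by_cases hk : ∃ k, Sum.inl k ∈ S
    · obtain ⟨k, hk⟩ := hk
      exact Or.inr (exists_segmentCode_of_connected hS hk)
    · exact Or.inl (exists_eq_singleton_of_connected hS (not_exists.1 hk))
  · rintro (⟨l, rfl⟩ | ⟨⟨b, a, A, B⟩, hc, rfl⟩)
    · exact ⟨Preconnected.of_subsingleton⟩
    · exact connected_segmentWithLeaves hc

end Counting


/-- For `2s ≤ n - 3`, the total number of subtrees of `T_{n,s}` is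
`2s + C(n - 2s - 1, 2) + 2(n - 2s - 1)·2^s + 2^{2s}`, where `C(m, 2) = m(m-1)/2`. -/
theorem numSubtrees_Tns (n s : ℕ) (h : 2 * s + 3 ≤ n) :
    numSubtrees (Tns n s)
      = 2 * s + (n - 2 * s - 1) * (n - 2 * s - 2) / 2
          + 2 * (n - 2 * s - 1) * 2 ^ s + 2 ^ (2 * s) := by
  rw [numSubtrees_eq_ncard_connected (Tns_isAcyclic n s), setOf_connected_Tns,
    Set.ncard_union_eq, segmentWithLeaves_injOn.ncard_image, Set.ncard_coe_finset,
    card_segmentCodes (by omega), ← Set.image_univ, Set.ncard_image_of_injective, Set.ncard_univ,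
    Nat.card_eq_fintype_card, Fintype.card_sum, Fintype.card_fin]
  · ring
  · intro l l' hll
    simpa using hll
  · rw [Set.disjoint_left]
    rintro _ ⟨l, rfl⟩ ⟨⟨b, a, A, B⟩, hc, heq⟩
    obtain ⟨hb, ha, -, -⟩ := mem_segmentCodes.1 hc
    have hmem := (Set.ext_iff.1 heq (Sum.inl ⟨b, hb⟩)).1 ⟨ha, le_rfl⟩
    simp at hmem

end SubtreePaper
end
end
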